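/- Suppose f : S² → S² is a continuous map, 𝒜 is an f-stable countable set of disjoint α-paths, and Φ is a regluing of 𝒜 into a set ℬ of disjoint β-paths. Then there exists a continuous map g : S² → S² such that g(Φ(x)) = Φ(f(x)) for every x ∈ S² ∖ Im 𝒜 (note that f(x) ∈ S² ∖ Im 𝒜 by backward invariance, so Φ(f(x)) is defined). -/

import Mathlib

open Set Filter Topology OnePoint

noncomputable section

abbrev Sph : Type := Metric.sphere (0 : EuclideanSpace ℝ (Fin 3)) 1

/-- The unit circle in the plane. -/
def circS : Set (ℝ × ℝ) := {p | p.1 ^ 2 + p.2 ^ 2 = 1}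

abbrev OP : Type := OnePoint (ℝ × ℝ)

/-- The closed outside `Δ̄∞` of the unit circle in the one-point compactification of the plane. -/
def deltaBar : Set OP := insert ∞ ((fun p : ℝ × ℝ => (p : OP)) '' {p | 1 ≤ p.1 ^ 2 + p.2 ^ 2})

/-- The unit circle viewed inside the one-point compactification of the plane. -/
def circOP : Set OP := (fun p : ℝ × ℝ => (p : OP)) '' circS

/-- The open outside `Δ∞` of the unit circle. -/
def deltaInf : Set OP := deltaBar \ circOP

/-- An α-path: `α (t₁,t₂) = α (t₁',t₂')` iff `t₁ = t₁'` and `t₂ = ±t₂'`. -/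
def IsAlphaPath (α : ℝ × ℝ → Sph) : Prop :=
  ContinuousOn α circS ∧
    ∀ p ∈ circS, ∀ q ∈ circS, (α p = α q ↔ p.1 = q.1 ∧ (p.2 = q.2 ∨ p.2 = -q.2))

/-- A β-path: `β (t₁,t₂) = β (t₁',t₂')` iff `t₁ = ±t₁'` and `t₂ = t₂'`. -/
def IsBetaPath (β : ℝ × ℝ → Sph) : Prop :=
  ContinuousOn β circS ∧
    ∀ p ∈ circS, ∀ q ∈ circS, (β p = β q ↔ (p.1 = q.1 ∨ p.1 = -q.1) ∧ p.2 = q.2)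

/-- The image of a path (its values on the unit circle). -/
def pathIm (α : ℝ × ℝ → Sph) : Set Sph := α '' circS

/-- `Im 𝒜`: the union of the images of the members of a family of paths. -/
def famIm (A : Set (ℝ × ℝ → Sph)) : Set Sph := ⋃ α ∈ A, pathIm α

/-- A family of paths with pairwise disjoint images. -/
def DisjointPaths (A : Set (ℝ × ℝ → Sph)) : Prop :=
  A.Pairwise fun α α' => Disjoint (pathIm α) (pathIm α')

/-- `ext` is an extension `α̂ : Δ̄∞ → S²` of the α-path `α`: it is continuous on `Δ̄∞`,
restricts to `α` on the unit circle, and maps `Δ∞` homeomorphically onto `S² ∖ α(S¹)`. -/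
def IsExtension (α : ℝ × ℝ → Sph) (ext : OP → Sph) : Prop :=
  ContinuousOn ext deltaBar ∧ (∀ p ∈ circS, ext (p : OP) = α p) ∧
    Topology.IsEmbedding (deltaInf.restrict ext) ∧ ext '' deltaInf = (pathIm α)ᶜ

/-- `Φ` is a regluing of the family `A` of α-paths (with chosen extensions `ext`) into the
family `B` of β-paths, according to the correspondence `b : α ↦ β_α`.  Only the values of `Φ`
on `S² ∖ Im A` matter: `Φ` restricts to a continuous bijection `S² ∖ Im A → S² ∖ Im B`, and
for every `α ∈ A` and `p ∈ S¹`, `Φ (α̂ z)` tends to `β_α p` as `z` tends to `p` within `Δ∞`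
(along the points where `Φ` is defined, i.e. where `α̂ z ∉ Im A`). -/
structure IsRegluing (A : Set (ℝ × ℝ → Sph)) (ext : (ℝ × ℝ → Sph) → OP → Sph)
    (B : Set (ℝ × ℝ → Sph)) (b : (ℝ × ℝ → Sph) → ℝ × ℝ → Sph) (Φ : Sph → Sph) : Prop where
  bijOn : Set.BijOn Φ (famIm A)ᶜ (famIm B)ᶜ
  contOn : ContinuousOn Φ (famIm A)ᶜ
  tendsto : ∀ α ∈ A, ∀ p ∈ circS,
    Filter.Tendsto (fun z => Φ (ext α z))
      (𝓝[deltaInf ∩ ext α ⁻¹' (famIm A)ᶜ] ((p : ℝ × ℝ) : OP)) (𝓝 (b α p))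

/-- The data of a set `A` of disjoint α-paths with chosen extensions `ext`, a set `B` of
disjoint β-paths, and a bijection `b : α ↦ β_α` from `A` to `B`. -/
structure RegluingData (A : Set (ℝ × ℝ → Sph)) (ext : (ℝ × ℝ → Sph) → OP → Sph)
    (B : Set (ℝ × ℝ → Sph)) (b : (ℝ × ℝ → Sph) → ℝ × ℝ → Sph) : Prop where
  alpha : ∀ α ∈ A, IsAlphaPath α
  disjA : DisjointPaths A
  extOk : ∀ α ∈ A, IsExtension α (ext α)
  beta : ∀ β ∈ B, IsBetaPath β
  disjB : DisjointPaths B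
  bij : Set.BijOn b A B

/-- A countable set `A` of disjoint α-paths is `f`-stable: (i) for every `α ∈ A`, either the
path `f ∘ α` belongs to `A`, or `f (α (t₁,t₂)) = f (α (-t₁,t₂))` for all `(t₁,t₂) ∈ S¹` and
`f (α (S¹))` is disjoint from `Im A`; (ii) `f⁻¹ (Im A) ⊆ Im A`. -/
def FStable (f : Sph → Sph) (A : Set (ℝ × ℝ → Sph)) : Prop :=
  (∀ α ∈ A,
      (∃ α' ∈ A, ∀ p ∈ circS, f (α p) = α' p) ∨
        ((∀ p ∈ circS, f (α p) = f (α (-p.1, p.2))) ∧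
          Disjoint (f '' pathIm α) (famIm A))) ∧
    f ⁻¹' famIm A ⊆ famIm A


abbrev E2 : Type := EuclideanSpace ℝ (Fin 2)

lemma chart_exists (c : Sph) : ∃ (e : E2 → Sph) (e' : Sph → E2), Continuous e ∧
    ContinuousOn e' {c}ᶜ ∧ (∀ x, x ≠ c → e (e' x) = x) ∧ (∀ w, e w ≠ c) ∧ (∀ w, e' (e w) = w) := by
  haveI : Fact (Module.finrank ℝ (EuclideanSpace ℝ (Fin 3)) = 2 + 1) := ⟨by simp⟩
  let s := stereographic' 2 c
  have hs : s.source = {c}ᶜ := stereographic'_source c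
  have ht : s.target = univ := stereographic'_target c
  refine ⟨s.symm, s, ?_, ?_, ?_, ?_, ?_⟩
  · rw [← continuousOn_univ, ← ht]; exact s.continuousOn_symm
  · rw [← hs]; exact s.continuousOn
  · intro x hx
    exact s.left_inv (by rw [hs]; exact hx)
  · intro w
    have : s.symm w ∈ s.source := s.map_target (by rw [ht]; trivial)
    rw [hs] at this; exact this
  · intro w
    exact s.right_inv (by rw [ht]; trivial)

lemma exists_ne_sph (P : Sph) : ∃ c : Sph, c ≠ P := by
  refine ⟨-P, ?_⟩
  exact (ne_neg_of_mem_unit_sphere ℝ P).symm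

lemma nhd_conn (P : Sph) (D : Set Sph) (hD : D ∈ 𝓝 P) :
    ∃ V ∈ 𝓝 P, V ⊆ D ∧ IsPreconnected V ∧ IsPreconnected (V \ {P}) := by
  obtain ⟨c, hc⟩ := exists_ne_sph P
  obtain ⟨e, e', he, he', h1, h2, h3⟩ := chart_exists c
  have hP : e (e' P) = P := h1 P hc.symm
  have hDp : e ⁻¹' D ∈ 𝓝 (e' P) := he.continuousAt.preimage_mem_nhds (by rwa [hP])
  obtain ⟨r, hr, hrD⟩ := Metric.mem_nhds_iff.1 hDp
  have him : ∀ s : Set E2, e '' s = {x | x ≠ c ∧ e' x ∈ s} := by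
    intro s; ext x; constructor
    · rintro ⟨w, hw, rfl⟩; exact ⟨h2 w, by rwa [h3]⟩
    · rintro ⟨hx, hw⟩; exact ⟨_, hw, h1 x hx⟩
  have hinj : Function.Injective e := Function.LeftInverse.injective h3
  let B := OpenPartialHomeomorph.univBall (e' P) r
  have hBs : B.source = univ := OpenPartialHomeomorph.univBall_source _ _
  have hBt : B.target = Metric.ball (e' P) r := OpenPartialHomeomorph.univBall_target _ hr
  have hB0 : B 0 = e' P := OpenPartialHomeomorph.univBall_apply_zero _ _
  refine ⟨e '' Metric.ball (e' P) r, ?_, ?_, ?_, ?_⟩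
  · rw [him]
    have a1 : {c}ᶜ ∈ 𝓝 P := isOpen_compl_singleton.mem_nhds hc.symm
    have a2 := (he'.continuousAt a1).preimage_mem_nhds (Metric.ball_mem_nhds _ hr)
    exact Filter.inter_mem a1 a2
  · rintro _ ⟨w, hw, rfl⟩; exact hrD hw
  · exact ((convex_ball (e' P) r).isPreconnected).image e he.continuousOn
  · have : e '' Metric.ball (e' P) r \ {P} = e '' (B '' {0}ᶜ) := by
      have : B '' {0}ᶜ = Metric.ball (e' P) r \ {e' P} := by
        ext w; constructor
        · rintro ⟨z, hz, rfl⟩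
          refine ⟨hBt ▸ B.map_source (by rw [hBs]; trivial), ?_⟩
          intro h
          rw [mem_singleton_iff, ← hB0] at h
          exact hz (B.injOn (by rw [hBs]; trivial) (by rw [hBs]; trivial) h)
        · rintro ⟨hw, hw2⟩
          rw [← hBt] at hw
          refine ⟨B.symm w, ?_, B.right_inv hw⟩
          intro h
          rw [mem_singleton_iff] at h
          apply hw2
          rw [mem_singleton_iff, ← hB0, ← h, B.right_inv hw]
      rw [this, image_sdiff hinj, image_singleton, hP]
    rw [this]
    have hB : Continuous B := by
      rw [← continuousOn_univ, ← hBs]; exact B.continuousOn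
    exact ((isConnected_compl_singleton_of_one_lt_rank (by
      rw [← Module.finrank_eq_rank]; simp) 0).isPreconnected.image B hB.continuousOn).image e he.continuousOn

lemma lift_circle (c : Sph) (F : Sph → Circle) (hF : ContinuousOn F {c}ᶜ) :
    ∃ h : Sph → ℝ, ContinuousOn h {c}ᶜ ∧ ∀ x, x ≠ c → Circle.exp (h x) = F x := by
  obtain ⟨e, e', he, he', h1, h2, h3⟩ := chart_exists c
  have hG : Continuous (F ∘ e) := hF.comp_continuous he (fun w => h2 w)
  obtain ⟨t, ht⟩ : ∃ t, Circle.exp t = F (e 0) := ⟨_, Circle.exp_arg _⟩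
  haveI : SimplyConnectedSpace E2 := SimplyConnectedSpace.ofContractible E2
  obtain ⟨g, ⟨-, hg⟩, -⟩ := Circle.isCoveringMap_exp.existsUnique_continuousMap_lifts ⟨F ∘ e, hG⟩ 0 t ht
  refine ⟨g ∘ e', g.continuous.comp_continuousOn he', fun x hx => ?_⟩
  have := congrFun hg (e' x)
  simp [h1 x hx] at this
  exact this

def NS (K : Set Sph) (a b : Sph) : Prop := ∀ u : Sph → ℤ, ContinuousOn u Kᶜ → u a = u b

lemma NS.mono {K K' : Set Sph} {a b : Sph} (h : NS K' a b) (hK : K ⊆ K') : NS K a b :=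
  fun u hu => h u (hu.mono (compl_subset_compl.2 hK))

lemma NS.real {K : Set Sph} {a b : Sph} (h : NS K a b) (ha : a ∉ K) (hb : b ∉ K)
    (v : Sph → ℝ) (hv : ContinuousOn v Kᶜ) (hi : ∀ x ∉ K, ∃ n : ℤ, v x = n) : v a = v b := by
  choose! n hn using hi
  have hc : ContinuousOn n Kᶜ := by
    have h1 : ContinuousOn (fun x => ((n x : ℤ) : ℝ)) Kᶜ := hv.congr (fun x hx => (hn x hx).symm)
    intro x hx
    exact (Int.isClosedEmbedding_coe_real.isEmbedding.isInducing.continuousWithinAt_iff).2 (h1 x hx)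
  have := h n hc
  rw [hn a ha, hn b hb, this]

lemma prod_contAt (ψ w : Sph → ℝ) (x : Sph) (hψ : ContinuousAt ψ x) (h0 : ψ x = 0)
    (hw : ∀ y, |w y| ≤ 1) : ContinuousAt (fun y => ψ y * w y) x := by
  unfold ContinuousAt
  simp only [h0, zero_mul]
  have h1 : Tendsto (fun y => |ψ y|) (𝓝 x) (𝓝 0) := by
    have := hψ.abs
    unfold ContinuousAt at this
    simpa [h0] using this
  refine squeeze_zero_norm (fun y => ?_) h1
  rw [Real.norm_eq_abs, abs_mul]
  exact mul_le_of_le_one_right (abs_nonneg _) (hw y)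

lemma janis {K1 K2 : Set Sph} {a b c : Sph} (hK1 : IsClosed K1) (hK2 : IsClosed K2)
    (hc : K1 ∩ K2 = {c}) (ha1 : a ∉ K1) (ha2 : a ∉ K2) (hb1 : b ∉ K1) (hb2 : b ∉ K2)
    (h1 : NS K1 a b) (h2 : NS K2 a b) : NS (K1 ∪ K2) a b := by
  intro u hu
  have hcc : c ∈ K1 ∩ K2 := by rw [hc]; rfl
  let w : Sph → ℝ := fun x => if u x = u a then 1 else 0
  have hw01 : ∀ x, w x = 0 ∨ w x = 1 := by
    intro x; by_cases h : u x = u a <;> simp [w, h]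
  have hwabs : ∀ x, |w x| ≤ 1 := by
    intro x; rcases hw01 x with h | h <;> simp [h]
  have hwc : ∀ x, x ∉ K1 → x ∉ K2 → ContinuousAt w x := by
    intro x hx1 hx2
    have : ContinuousAt u x :=
      hu.continuousAt ((hK1.union hK2).isOpen_compl.mem_nhds (by
        rintro (h | h)
        · exact hx1 h
        · exact hx2 h))
    exact (continuous_of_discreteTopology (f := fun n : ℤ => if n = u a then (1:ℝ) else 0)).continuousAt.comp this
  let φ : Sph → ℝ := fun x => Metric.infDist x K1 / (Metric.infDist x K1 + Metric.infDist x K2)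
  have hz1 : ∀ x, x ∈ K1 ↔ Metric.infDist x K1 = 0 := fun x =>
    hK1.mem_iff_infDist_zero ⟨c, hcc.1⟩
  have hz2 : ∀ x, x ∈ K2 ↔ Metric.infDist x K2 = 0 := fun x =>
    hK2.mem_iff_infDist_zero ⟨c, hcc.2⟩
  have hpos : ∀ x, x ≠ c → Metric.infDist x K1 + Metric.infDist x K2 ≠ 0 := by
    intro x hx h
    have p1 : 0 ≤ Metric.infDist x K1 := Metric.infDist_nonneg
    have p2 : 0 ≤ Metric.infDist x K2 := Metric.infDist_nonneg
    have : x ∈ K1 ∩ K2 := ⟨(hz1 x).2 (by linarith), (hz2 x).2 (by linarith)⟩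
    rw [hc] at this; exact hx this
  have hφ : ∀ x, x ≠ c → ContinuousAt φ x := by
    intro x hx
    exact (Metric.continuous_infDist_pt K1).continuousAt.div
      ((Metric.continuous_infDist_pt K1).add (Metric.continuous_infDist_pt K2)).continuousAt (hpos x hx)
  have hw1 : ∀ x, x ∉ K2 → ContinuousAt (fun y => φ y * w y) x := by
    intro x hx
    have hxc : x ≠ c := fun h => hx (h ▸ hcc.2)
    by_cases hx1 : x ∈ K1
    · exact prod_contAt φ w x (hφ x hxc) (by simp [φ, (hz1 x).1 hx1]) hwabs
    · exact (hφ x hxc).mul (hwc x hx1 hx)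
  have hw2 : ∀ x, x ∉ K1 → ContinuousAt (fun y => (φ y - 1) * w y) x := by
    intro x hx
    have hxc : x ≠ c := fun h => hx (h ▸ hcc.1)
    by_cases hx1 : x ∈ K2
    · refine prod_contAt (fun y => φ y - 1) w x ((hφ x hxc).sub continuousAt_const) ?_ hwabs
      have := hpos x hxc
      rw [(hz2 x).1 hx1, add_zero] at this
      simp only [φ, (hz2 x).1 hx1, add_zero]
      rw [div_self this, sub_self]
    · exact ((hφ x hxc).sub continuousAt_const).mul (hwc x hx hx1)
  let F : Sph → Circle := fun x => Circle.exp (2 * Real.pi * (φ x * w x))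
  have hF2 : F = fun x => Circle.exp (2 * Real.pi * ((φ x - 1) * w x)) := by
    funext x
    rcases hw01 x with h | h
    · simp [F, h]
    · have : 2 * Real.pi * (φ x * w x) = 2 * Real.pi * ((φ x - 1) * w x) + 2 * Real.pi := by
        rw [h]; ring
      simp only [F]
      rw [this, Circle.exp_add, Circle.exp_two_pi, mul_one]
  have hF : ContinuousOn F {c}ᶜ := by
    intro x hx
    apply ContinuousAt.continuousWithinAt
    by_cases hx2 : x ∈ K2
    · have hx1 : x ∉ K1 := fun h => hx (by rw [← hc]; exact ⟨h, hx2⟩)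
      rw [hF2]
      exact Circle.exp.continuous.continuousAt.comp (continuousAt_const.mul (hw2 x hx1))
    · exact Circle.exp.continuous.continuousAt.comp (continuousAt_const.mul (hw1 x hx2))
  obtain ⟨h, hh, hhF⟩ := lift_circle c F hF
  have hpi : (2 * Real.pi) ≠ 0 := by positivity
  have key : ∀ s t : ℝ, Circle.exp s = Circle.exp (2 * Real.pi * t) → ∃ n : ℤ, s / (2 * Real.pi) - t = n := by
    intro s t hst
    obtain ⟨m, hm⟩ := Circle.exp_eq_exp.1 hst
    refine ⟨m, ?_⟩
    rw [hm]; field_simp; ring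
  have r1 := h2.real ha2 hb2 (fun x => h x / (2 * Real.pi) - φ x * w x) (by
    intro x hx
    have hxc : x ≠ c := fun h => hx (h ▸ hcc.2)
    exact (((hh.continuousAt (isOpen_compl_singleton.mem_nhds hxc)).div_const _).sub (hw1 x hx)).continuousWithinAt) (by
    intro x hx
    have hxc : x ≠ c := fun h => hx (h ▸ hcc.2)
    exact key _ _ (hhF x hxc))
  have r2 := h1.real ha1 hb1 (fun x => h x / (2 * Real.pi) - (φ x - 1) * w x) (by
    intro x hx
    have hxc : x ≠ c := fun h => hx (h ▸ hcc.1)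
    exact (((hh.continuousAt (isOpen_compl_singleton.mem_nhds hxc)).div_const _).sub (hw2 x hx)).continuousWithinAt) (by
    intro x hx
    have hxc : x ≠ c := fun h => hx (h ▸ hcc.1)
    refine key _ _ ((hhF x hxc).trans ?_)
    rw [hF2])
  have : w a = w b := by
    linarith
  have hwa : w a = 1 := by simp [w]
  by_contra hne
  have hwb : w b = 0 := by simp [w, Ne.symm hne]
  linarith

lemma NS.of_preconn {K S : Set Sph} {a b : Sph} (hS : IsPreconnected S) (ha : a ∈ S) (hb : b ∈ S)
    (h : Disjoint S K) : NS K a b := by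
  intro u hu
  exact hS.constant (hu.mono h.subset_compl_right) ha hb

lemma NS.small {a b c : Sph} (ha : a ≠ c) (hb : b ≠ c) : ∃ V ∈ 𝓝 c, ∀ K ⊆ V, NS K a b := by
  obtain ⟨e, e', he, he', h1, h2, h3⟩ := chart_exists c
  let S := e '' segment ℝ (e' a) (e' b)
  have hS : IsPreconnected S := (convex_segment _ _).isPreconnected.image e he.continuousOn
  have hSc : IsClosed S := by
    have : IsCompact (segment ℝ (e' a) (e' b)) := by
      rw [segment_eq_image_lineMap]
      exact isCompact_Icc.image AffineMap.lineMap_continuous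
    exact (this.image he).isClosed
  refine ⟨Sᶜ, hSc.isOpen_compl.mem_nhds ?_, fun K hK => NS.of_preconn hS ?_ ?_ ?_⟩
  · rintro ⟨w, -, hw⟩; exact h2 w hw
  · exact ⟨_, left_mem_segment _ _ _, h1 a ha⟩
  · exact ⟨_, right_mem_segment _ _ _, h1 b hb⟩
  · exact disjoint_left.2 fun x hx hxK => hK hxK hx

lemma img_Icc_closed {γ : ℝ → Sph} {s t s' t' : ℝ} (hγ : ContinuousOn γ (Icc s t)) (h : Icc s' t' ⊆ Icc s t) :
    IsClosed (γ '' Icc s' t') :=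
  (isCompact_Icc.image_of_continuousOn (hγ.mono h)).isClosed

lemma arc_NS {γ : ℝ → Sph} {s t : ℝ} (hγ : ContinuousOn γ (Icc s t)) (hi : InjOn γ (Icc s t))
    (hst : s ≤ t) {a b : Sph} (ha : a ∉ γ '' Icc s t) (hb : b ∉ γ '' Icc s t) :
    NS (γ '' Icc s t) a b := by
  have step : ∀ r ∈ Icc s t, ∃ ε > 0, ∀ r1 ∈ Icc s t, ∀ r2 ∈ Icc s t, r1 ≤ r2 → dist r1 r < ε →
      dist r2 r < ε → NS (γ '' Icc s r1) a b → NS (γ '' Icc s r2) a b := by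
    intro r hr
    have har : a ≠ γ r := fun h => ha ⟨r, hr, h.symm⟩
    have hbr : b ≠ γ r := fun h => hb ⟨r, hr, h.symm⟩
    obtain ⟨V, hV, hVK⟩ := NS.small har hbr
    obtain ⟨ε, hε, hεV⟩ := Metric.mem_nhdsWithin_iff.1 (hγ r hr hV)
    refine ⟨ε, hε, fun r1 h1 r2 h2 h12 d1 d2 hN => ?_⟩
    have e1 : γ '' Icc s r2 = γ '' Icc s r1 ∪ γ '' Icc r1 r2 := by
      rw [← image_union, Icc_union_Icc_eq_Icc h1.1 h12]
    rw [e1]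
    have s1 : Icc s r1 ⊆ Icc s t := Icc_subset_Icc le_rfl h1.2
    have s2 : Icc r1 r2 ⊆ Icc s t := Icc_subset_Icc h1.1 h2.2
    refine janis (c := γ r1) (img_Icc_closed hγ s1) (img_Icc_closed hγ s2) ?_
      (fun h => ha (image_mono s1 h)) (fun h => ha (image_mono s2 h))
      (fun h => hb (image_mono s1 h)) (fun h => hb (image_mono s2 h)) hN (hVK _ ?_)
    · rw [← hi.image_inter s1 s2]
      have : Icc s r1 ∩ Icc r1 r2 = {r1} := by
        ext x; simp only [mem_inter_iff, mem_Icc, mem_singleton_iff]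
        constructor
        · rintro ⟨h, h'⟩; linarith
        · rintro rfl; exact ⟨⟨h1.1, le_rfl⟩, le_rfl, h12⟩
      rw [this, image_singleton]
    · rintro _ ⟨x, hx, rfl⟩
      refine hεV ⟨?_, s2 hx⟩
      rw [Real.dist_eq, abs_lt] at d1 d2
      rw [Metric.mem_ball, Real.dist_eq, abs_lt]
      constructor <;> linarith [hx.1, hx.2]
  let S : Set ℝ := {r | NS (γ '' Icc s r) a b}
  have hmono : ∀ r r', r ≤ r' → r' ∈ S → r ∈ S := fun r r' h hr' =>
    NS.mono hr' (image_mono (Icc_subset_Icc le_rfl h))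
  have hclosed : IsClosed (S ∩ Icc s t) := by
    apply isClosed_of_closure_subset
    intro r hr
    have hrI : r ∈ Icc s t := by
      have := closure_mono inter_subset_right hr
      rwa [isClosed_Icc.closure_eq] at this
    obtain ⟨ε, hε, h⟩ := step r hrI
    obtain ⟨r', ⟨hr'S, hr'I⟩, hd⟩ := Metric.mem_closure_iff.1 hr ε hε
    refine ⟨?_, hrI⟩
    rcases le_total r r' with h' | h'
    · exact hmono _ _ h' hr'S
    · exact h r' hr'I r hrI h' (by rwa [dist_comm]) (by simpa using hε) hr'S
  have hs : s ∈ S := by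
    have hs' : s ∈ Icc s t := left_mem_Icc.2 hst
    obtain ⟨V, hV, hVK⟩ := NS.small (a := a) (b := b) (c := γ s) (fun h => ha ⟨s, hs', h.symm⟩) (fun h => hb ⟨s, hs', h.symm⟩)
    refine hVK _ ?_
    rw [Icc_self, image_singleton, singleton_subset_iff]
    exact mem_of_mem_nhds hV
  refine hclosed.Icc_subset_of_forall_mem_nhdsWithin hs ?_ (right_mem_Icc.2 hst)
  rintro r ⟨hrS, hrI⟩
  have hrI' : r ∈ Icc s t := Ico_subset_Icc_self hrI
  obtain ⟨ε, hε, h⟩ := step r hrI'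
  have : Ioo r (min t (r + ε)) ∈ 𝓝[>] r := Ioo_mem_nhdsGT (lt_min hrI.2 (by linarith))
  filter_upwards [this] with x hx
  have hx1 := lt_of_lt_of_le hx.2 (min_le_left _ _)
  have hx2 := lt_of_lt_of_le hx.2 (min_le_right _ _)
  refine h r hrI' x ⟨hrI.1.trans hx.1.le, hx1.le⟩ hx.1.le (by simpa using hε) ?_ hrS
  rw [Real.dist_eq, abs_lt]; constructor <;> linarith [hx.1]

lemma tip {γ : ℝ → Sph} {s t : ℝ} (hγ : ContinuousOn γ (Icc s t)) (hi : InjOn γ (Icc s t))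
    (hst : s < t) {D : Set Sph} (hD : IsOpen D) (htD : γ t ∈ D) (u : Sph → ℤ)
    (hu : ContinuousOn u (D \ γ '' Icc s t)) :
    ∃ V ∈ 𝓝 (γ t), ∀ a ∈ V, ∀ b ∈ V, a ∉ γ '' Icc s t → b ∉ γ '' Icc s t → u a = u b := by
  have htI : t ∈ Icc s t := right_mem_Icc.2 hst.le
  obtain ⟨ε, hε, hεV⟩ := Metric.mem_nhdsWithin_iff.1 (hγ t htI (hD.mem_nhds htD))
  let c := max s (t - ε / 2)
  have hct : c < t := max_lt hst (by linarith)
  have hsc : s ≤ c := le_max_left _ _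
  have s1 : Icc c t ⊆ Icc s t := Icc_subset_Icc hsc le_rfl
  have s2 : Icc s c ⊆ Icc s t := Icc_subset_Icc le_rfl hct.le
  have hcD : γ '' Icc c t ⊆ D := by
    rintro _ ⟨x, hx, rfl⟩
    refine hεV ⟨?_, s1 hx⟩
    have : t - ε / 2 ≤ c := le_max_right _ _
    rw [Metric.mem_ball, Real.dist_eq, abs_lt]
    constructor <;> linarith [hx.1, hx.2]
  have hK2 : IsClosed (Dᶜ ∪ γ '' Icc s c) := hD.isClosed_compl.union (img_Icc_closed hγ s2)
  have htK2 : γ t ∉ Dᶜ ∪ γ '' Icc s c := by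
    rintro (h | ⟨x, hx, hxt⟩)
    · exact h htD
    · have := hi (s2 hx) htI hxt
      linarith [hx.2]
  obtain ⟨V, hV, hVD, hVc, -⟩ := nhd_conn (γ t) _ (hK2.isOpen_compl.mem_nhds htK2)
  refine ⟨V, hV, fun a ha b hb haK hbK => ?_⟩
  have hun : γ '' Icc c t ∪ (Dᶜ ∪ γ '' Icc s c) = Dᶜ ∪ γ '' Icc s t := by
    rw [← Icc_union_Icc_eq_Icc hsc hct.le, image_union]
    ext x; simp only [mem_union]; tauto
  have := janis (a := a) (b := b) (c := γ c) (img_Icc_closed hγ s1) hK2 ?_ (fun h => haK (image_mono s1 h)) (hVD ha)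
    (fun h => hbK (image_mono s1 h)) (hVD hb)
    (arc_NS (hγ.mono s1) (hi.mono s1) hct.le (fun h => haK (image_mono s1 h)) (fun h => hbK (image_mono s1 h)))
    (NS.of_preconn hVc ha hb (disjoint_left.2 fun x hx => hVD hx))
  · rw [hun] at this
    refine this u ?_
    rwa [compl_union, compl_compl, ← diff_eq]
  · rw [inter_union_distrib_left, ← hi.image_inter s1 s2]
    have e1 : γ '' Icc c t ∩ Dᶜ = ∅ := by
      rw [← disjoint_iff_inter_eq_empty]
      exact disjoint_left.2 fun x hx h => h (hcD hx)
    have : Icc c t ∩ Icc s c = {c} := by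
      ext x; simp only [mem_inter_iff, mem_Icc, mem_singleton_iff]
      constructor
      · rintro ⟨h, h'⟩; linarith
      · rintro rfl; exact ⟨⟨le_rfl, hct.le⟩, hsc, le_rfl⟩
    rw [this, e1, image_singleton, empty_union]

lemma arc_interior {γ : ℝ → Sph} {s t : ℝ} (hγ : ContinuousOn γ (Icc s t)) (hi : InjOn γ (Icc s t))
    (hst : s < t) : interior (γ '' Icc s t) = ∅ := by
  rw [eq_empty_iff_forall_notMem]
  intro Q hQ
  obtain ⟨r0, hr0, rfl⟩ := interior_subset hQ
  have h1 : γ ⁻¹' interior (γ '' Icc s t) ∈ 𝓝[Icc s t] r0 := hγ r0 hr0 (isOpen_interior.mem_nhds hQ)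
  have hne : (𝓝[Ioo s t] r0).NeBot := by
    rw [← mem_closure_iff_nhdsWithin_neBot, closure_Ioo hst.ne]; exact hr0
  have h2 := nhdsWithin_mono r0 Ioo_subset_Icc_self h1
  obtain ⟨r, hr, hrI⟩ := hne.nonempty_of_mem (Filter.inter_mem h2 self_mem_nhdsWithin)
  have hrI' : r ∈ Icc s t := Ioo_subset_Icc_self hrI
  obtain ⟨V, hV, hVD, -, hVc⟩ := nhd_conn (γ r) _ (isOpen_interior.mem_nhds hr)
  have hVD : V ⊆ γ '' Icc s t := hVD.trans interior_subset
  have s1 : Icc s r ⊆ Icc s t := Icc_subset_Icc le_rfl hrI.2.le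
  have s2 : Icc r t ⊆ Icc s t := Icc_subset_Icc hrI.1.le le_rfl
  obtain ⟨ε, hε, hεV⟩ := Metric.mem_nhdsWithin_iff.1 (hγ r hrI' hV)
  have key := isPreconnected_closed_iff.1 hVc _ _ (img_Icc_closed hγ s1) (img_Icc_closed hγ s2) (by
    rw [← image_union, Icc_union_Icc_eq_Icc hrI.1.le hrI.2.le]
    exact diff_subset.trans hVD) ?_ ?_
  · obtain ⟨x, ⟨-, hx⟩, hx1, hx2⟩ := key
    have : x ∈ γ '' (Icc s r ∩ Icc r t) := by rw [hi.image_inter s1 s2]; exact ⟨hx1, hx2⟩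
    obtain ⟨z, hz, rfl⟩ := this
    have : z = r := le_antisymm hz.1.2 hz.2.1
    exact hx (by rw [this]; rfl)
  · let x := max s (r - ε / 2)
    have hx1 : s ≤ x := le_max_left _ _
    have hx2 : r - ε / 2 ≤ x := le_max_right _ _
    have hx3 : x < r := max_lt hrI.1 (by linarith)
    refine ⟨γ x, ⟨hεV ⟨?_, hx1, by linarith [hrI.2]⟩, ?_⟩, x, ⟨hx1, hx3.le⟩, rfl⟩
    · rw [Metric.mem_ball, Real.dist_eq, abs_lt]; constructor <;> linarith
    · intro h
      exact hx3.ne (hi ⟨hx1, by linarith [hrI.2]⟩ hrI' h)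
  · let x := min t (r + ε / 2)
    have hx1 : x ≤ t := min_le_left _ _
    have hx2 : x ≤ r + ε / 2 := min_le_right _ _
    have hx3 : r < x := lt_min hrI.2 (by linarith)
    refine ⟨γ x, ⟨hεV ⟨?_, by linarith [hrI.1], hx1⟩, ?_⟩, x, ⟨hx3.le, hx1⟩, rfl⟩
    · rw [Metric.mem_ball, Real.dist_eq, abs_lt]; constructor <;> linarith
    · intro h
      exact hx3.ne' (hi ⟨by linarith [hrI.1], hx1⟩ hrI' h)

lemma bump {X : Type} [TopologicalSpace X] [CompactSpace X] [T2Space X] {K W : Set X} (hK : IsClosed K)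
    (hKc : IsPreconnected K) (hW : IsOpen W) (hKW : ¬ K ⊆ W) {x : X} (hxK : x ∈ K) (hxW : x ∈ W) :
    ∃ K' ⊆ K, K' ⊆ closure W ∧ IsClosed K' ∧ IsPreconnected K' ∧ x ∈ K' ∧ ¬ K' ⊆ W := by
  let K1 := K ∩ closure W
  have hK1 : IsClosed K1 := hK.inter isClosed_closure
  have hxK1 : x ∈ K1 := ⟨hxK, subset_closure hxW⟩
  haveI : CompactSpace K1 := isCompact_iff_compactSpace.1 hK1.isCompact
  let x1 : K1 := ⟨x, hxK1⟩
  have hemb := hK1.isClosedEmbedding_subtypeVal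
  refine ⟨Subtype.val '' connectedComponent x1, ?_, ?_, ?_, ?_, ?_, ?_⟩
  · rintro _ ⟨z, -, rfl⟩; exact z.2.1
  · rintro _ ⟨z, -, rfl⟩; exact z.2.2
  · exact hemb.isClosedMap _ isClosed_connectedComponent
  · exact isPreconnected_connectedComponent.image _ continuous_subtype_val.continuousOn
  · exact ⟨x1, mem_connectedComponent, rfl⟩
  · intro hsub
    haveI : Nonempty { s : Set K1 // IsClopen s ∧ x1 ∈ s } := ⟨⟨univ, isClopen_univ, trivial⟩⟩
    obtain ⟨⟨Z, hZc, hxZ⟩, hZW⟩ := exists_subset_nhds_of_compactSpace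
      (V := fun s : { s : Set K1 // IsClopen s ∧ x1 ∈ s } => (s : Set K1)) (by
        rintro ⟨s, hs, hxs⟩ ⟨t, ht, hxt⟩
        exact ⟨⟨s ∩ t, hs.inter ht, hxs, hxt⟩, inter_subset_left, inter_subset_right⟩)
      (fun s => s.2.1.isClosed) (U := Subtype.val ⁻¹' W) (by
        intro z hz
        rw [← connectedComponent_eq_iInter_isClopen] at hz
        exact (hW.preimage continuous_subtype_val).mem_nhds (hsub ⟨z, hz, rfl⟩))
    obtain ⟨k, hk, hkW⟩ := not_subset.1 hKW
    obtain ⟨z, hzK, hz1, hz2⟩ := isPreconnected_closed_iff.1 hKc (Subtype.val '' Z) (Wᶜ ∪ Subtype.val '' Zᶜ)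
      (hemb.isClosedMap _ hZc.isClosed) (hW.isClosed_compl.union (hemb.isClosedMap _ hZc.compl.isClosed)) (by
        intro z hz
        by_cases hzW : z ∈ W
        · by_cases h : (⟨z, hz, subset_closure hzW⟩ : K1) ∈ Z
          · exact Or.inl ⟨_, h, rfl⟩
          · exact Or.inr (Or.inr ⟨_, h, rfl⟩)
        · exact Or.inr (Or.inl hzW)) ⟨x, hxK, x1, hxZ, rfl⟩ ⟨k, hk, Or.inl hkW⟩
    obtain ⟨w, hw, rfl⟩ := hz1
    rcases hz2 with h | ⟨w', hw', he⟩
    · exact h (hZW hw)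
    · exact hw' (by rwa [Subtype.val_injective he])

lemma sierp {X : Type} [TopologicalSpace X] [CompactSpace X] [T2Space X] (C : ℕ → Set X)
    (hC : ∀ n, IsClosed (C n)) (hd : ∀ m n, C m = C n ∨ Disjoint (C m) (C n)) {K : Set X}
    (hK : IsClosed K) (hKc : IsPreconnected K) (hne : K.Nonempty) (hKC : K ⊆ ⋃ n, C n) :
    ∃ n, K ⊆ C n := by
  by_contra! hno
  let P : Set X → Prop := fun L => IsClosed L ∧ IsPreconnected L ∧ L.Nonempty ∧ L ⊆ K ∧ ∀ m, ¬ L ⊆ C m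
  have step : ∀ (L : {L // P L}) (n : ℕ), ∃ L' : {L // P L}, L'.1 ⊆ L.1 ∧ Disjoint L'.1 (C n) := by
    rintro ⟨L, hL1, hL2, hL3, hL4, hL5⟩ n
    by_cases hdis : Disjoint L (C n)
    · exact ⟨⟨L, hL1, hL2, hL3, hL4, hL5⟩, subset_rfl, hdis⟩
    obtain ⟨y, hyL, hyC⟩ := not_disjoint_iff.1 hdis
    obtain ⟨x, hxL, hxC⟩ := not_subset.1 (hL5 n)
    obtain ⟨m, hxm⟩ := mem_iUnion.1 (hKC (hL4 hxL))
    have hmn : Disjoint (C m) (C n) := (hd m n).resolve_left (fun h => hxC (h ▸ hxm))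
    obtain ⟨W, hW, hmW, hWn⟩ := normal_exists_closure_subset (hC m) (hC n).isOpen_compl
      hmn.subset_compl_right
    obtain ⟨L', h1, h2, h3, h4, h5, h6⟩ := bump hL1 hL2 hW
      (fun h => hWn (subset_closure (h hyL)) hyC) hxL (hmW hxm)
    refine ⟨⟨L', h3, h4, ⟨x, h5⟩, h1.trans hL4, fun k hk => ?_⟩, h1, ?_⟩
    · rcases hd m k with h | h
      · exact h6 (hk.trans (h ▸ hmW))
      · exact disjoint_left.1 h hxm (hk h5)
    · exact disjoint_left.2 fun z hz => hWn (h2 hz)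
  choose S hS1 hS2 using step
  let L : ℕ → {L // P L} := fun n => Nat.rec ⟨K, hK, hKc, hne, subset_rfl, hno⟩ (fun k Lk => S Lk k) n
  have hLs : ∀ n, L (n + 1) = S (L n) n := fun n => rfl
  have hI : (⋂ n, (L n).1).Nonempty :=
    IsCompact.nonempty_iInter_of_sequence_nonempty_isCompact_isClosed _
      (fun n => by rw [hLs]; exact hS1 _ _) (fun n => (L n).2.2.2.1) (L 0).2.1.isCompact
      (fun n => (L n).2.1)
  obtain ⟨z, hz⟩ := hI
  rw [mem_iInter] at hz
  obtain ⟨n, hn⟩ := mem_iUnion.1 (hKC (hz 0))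
  have := hz (n + 1)
  rw [hLs] at this
  exact disjoint_left.1 (hS2 _ _) this hn

lemma isolate {X : Type} [TopologicalSpace X] [CompactSpace X] [T2Space X] {ι : Type} (N Nb : Set ι)
    (hN : N.Countable) (I : ι → Set X) (hcl : ∀ i ∈ N, IsClosed (I i)) (hpc : ∀ i ∈ N, IsPreconnected (I i))
    (hne : ∀ i ∈ N, (I i).Nonempty) (hdis : ∀ i ∈ N, ∀ j ∈ N, i ≠ j → Disjoint (I i) (I j))
    (hF : IsClosed (⋃ i ∈ N, I i)) (hNb : Nb ⊆ N) (hNbne : Nb.Nonempty) :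
    ∃ i ∈ Nb, ∃ O : Set X, IsOpen O ∧ I i ⊆ O ∧ ∀ j ∈ Nb, j ≠ i → Disjoint O (I j) := by
  set F := ⋃ i ∈ N, I i with hFdef
  have hIF : ∀ i ∈ N, I i ⊆ F := fun i hi => subset_biUnion_of_mem hi
  haveI : CompactSpace F := isCompact_iff_compactSpace.1 hF.isCompact
  let π : F → ConnectedComponents F := (↑)
  have hπ : Continuous π := ConnectedComponents.continuous_coe
  obtain ⟨e, he⟩ := hN.exists_eq_range (hNbne.mono hNb)
  have heN : ∀ n, e n ∈ N := fun n => by rw [he]; exact ⟨n, rfl⟩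
  have hsep : ∀ i ∈ N, ∀ j ∈ N, ∀ z z' : F, z.1 ∈ I i → z'.1 ∈ I j → π z = π z' → i = j := by
    intro i hi j hj z z' hz hz' hzz
    have hzz' : z' ∈ connectedComponent z := by
      have := ConnectedComponents.coe_eq_coe.1 hzz
      rw [this]; exact mem_connectedComponent
    obtain ⟨n, hn⟩ := sierp (fun n => I (e n)) (fun n => hcl _ (heN n)) (by
        intro m n
        by_cases h : e m = e n
        · left; simp only [h]
        · right; exact hdis _ (heN m) _ (heN n) h)
      (K := Subtype.val '' connectedComponent z)
      (hF.isClosedEmbedding_subtypeVal.isClosedMap _ isClosed_connectedComponent)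
      (isPreconnected_connectedComponent.image _ continuous_subtype_val.continuousOn)
      ⟨z, z, mem_connectedComponent, rfl⟩ (by
        rintro _ ⟨w, -, rfl⟩
        obtain ⟨k, hk, hwk⟩ := mem_iUnion₂.1 w.2
        rw [he] at hk
        obtain ⟨n, rfl⟩ := hk
        exact mem_iUnion.2 ⟨n, hwk⟩)
    have h1 : z.1 ∈ I (e n) := hn ⟨z, mem_connectedComponent, rfl⟩
    have h2 : z'.1 ∈ I (e n) := hn ⟨z', hzz', rfl⟩
    have e1 : i = e n := by
      by_contra h; exact disjoint_left.1 (hdis _ hi _ (heN n) h) hz h1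
    have e2 : j = e n := by
      by_contra h; exact disjoint_left.1 (hdis _ hj _ (heN n) h) hz' h2
    rw [e1, e2]
  have hsame : ∀ i ∈ N, ∀ z z' : F, z.1 ∈ I i → z'.1 ∈ I i → π z = π z' := by
    intro i hi z z' hz hz'
    apply ConnectedComponents.coe_eq_coe.2
    have hp : IsPreconnected (Subtype.val ⁻¹' I i : Set F) := by
      refine (IsInducing.subtypeVal.isPreconnected_image).1 ?_
      rw [Subtype.image_preimage_coe, inter_eq_self_of_subset_right (hIF i hi)]
      exact hpc i hi
    exact (connectedComponent_eq (hp.subset_connectedComponent hz hz')).symm ▸ rfl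
  have hcount : Countable (ConnectedComponents F) := by
    choose x hx using fun n => hne (e n) (heN n)
    have : Function.Surjective (fun n => π ⟨x n, hIF _ (heN n) (hx n)⟩) := by
      intro c
      obtain ⟨w, rfl⟩ := ConnectedComponents.surjective_coe c
      obtain ⟨k, hk, hwk⟩ := mem_iUnion₂.1 w.2
      rw [he] at hk
      obtain ⟨n, rfl⟩ := hk
      exact ⟨n, hsame (e n) (heN n) _ _ (hx n) hwk⟩
    exact this.countable
  let T0 : Set (ConnectedComponents F) := π '' {z | ∃ i ∈ Nb, z.1 ∈ I i}
  let T := closure T0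
  haveI : CompactSpace T := isCompact_iff_compactSpace.1 isClosed_closure.isCompact
  obtain ⟨i0, hi0⟩ := hNbne
  obtain ⟨x0, hx0⟩ := hne i0 (hNb hi0)
  haveI : Nonempty T := ⟨⟨π ⟨x0, hIF _ (hNb hi0) hx0⟩, subset_closure ⟨_, ⟨i0, hi0, hx0⟩, rfl⟩⟩⟩
  obtain ⟨t, ht⟩ := nonempty_interior_of_iUnion_of_closed (f := fun t : T => ({t} : Set T))
    (fun t => isClosed_singleton) (by ext t; simp)
  have hto : IsOpen ({t} : Set T) := by
    obtain ⟨t', ht'⟩ := ht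
    have : t' = t := mem_singleton_iff.1 (interior_subset ht')
    rw [this] at ht'
    have : interior {t} = ({t} : Set T) := subset_antisymm interior_subset (by simpa using ht')
    rw [← this]; exact isOpen_interior
  obtain ⟨O', hO', hO't⟩ := isOpen_induced_iff.1 hto
  have htO : t.1 ∈ O' := by
    have : t ∈ Subtype.val ⁻¹' O' := by rw [hO't]; rfl
    exact this
  have huniq : ∀ s ∈ T, s ∈ O' → s = t.1 := by
    intro s hs hsO
    have : (⟨s, hs⟩ : T) ∈ Subtype.val ⁻¹' O' := hsO
    rw [hO't] at this
    exact congrArg Subtype.val this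
  obtain ⟨_, hsO, z, ⟨i, hi, hzi⟩, rfl⟩ := mem_closure_iff.1 t.2 O' hO' htO
  have hzt : π z = t.1 := huniq _ (subset_closure ⟨z, ⟨i, hi, hzi⟩, rfl⟩) hsO
  obtain ⟨O, hO, hOe⟩ := isOpen_induced_iff.1 (hO'.preimage hπ)
  refine ⟨i, hi, O, hO, ?_, ?_⟩
  · intro y hy
    have : (⟨y, hIF i (hNb hi) hy⟩ : F) ∈ π ⁻¹' O' := by
      show π _ ∈ O'
      rw [hsame i (hNb hi) ⟨y, hIF i (hNb hi) hy⟩ z hy hzi]; exact hsO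
    rw [← hOe] at this; exact this
  · intro j hj hji
    refine disjoint_left.2 fun y hyO hyj => hji ?_
    have h1 : (⟨y, hIF j (hNb hj) hyj⟩ : F) ∈ π ⁻¹' O' := by rw [← hOe]; exact hyO
    have h2 := huniq _ (subset_closure ⟨_, ⟨j, hj, hyj⟩, rfl⟩) h1
    exact hsep j (hNb hj) i (hNb hi) _ _ hyj hzi (h2.trans hzt.symm)

def cT (t : ℝ) : ℝ × ℝ := (√(1 - t ^ 2), t)
def cA (t : ℝ) : ℝ × ℝ := (t, √(1 - t ^ 2))

lemma one_sub_sq_nonneg {t : ℝ} (ht : t ∈ Icc (-1 : ℝ) 1) : 0 ≤ 1 - t ^ 2 := by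
  nlinarith [ht.1, ht.2]

lemma cT_mem {t : ℝ} (ht : t ∈ Icc (-1 : ℝ) 1) : cT t ∈ circS := by
  simp only [cT, circS, mem_setOf_eq]
  rw [Real.sq_sqrt (one_sub_sq_nonneg ht)]; ring

lemma cA_mem {t : ℝ} (ht : t ∈ Icc (-1 : ℝ) 1) : cA t ∈ circS := by
  simp only [cA, circS, mem_setOf_eq]
  rw [Real.sq_sqrt (one_sub_sq_nonneg ht)]; ring

lemma circ_fst {p : ℝ × ℝ} (hp : p ∈ circS) : p.1 ∈ Icc (-1 : ℝ) 1 := by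
  have : p.1 ^ 2 + p.2 ^ 2 = 1 := hp
  constructor <;> nlinarith [sq_nonneg p.2]

lemma circ_snd {p : ℝ × ℝ} (hp : p ∈ circS) : p.2 ∈ Icc (-1 : ℝ) 1 := by
  have : p.1 ^ 2 + p.2 ^ 2 = 1 := hp
  constructor <;> nlinarith [sq_nonneg p.1]

lemma circ_closed : IsClosed circS := by
  unfold circS
  exact isClosed_eq (by fun_prop) continuous_const

lemma circ_compact : IsCompact circS := by
  refine (isCompact_Icc.prod isCompact_Icc : IsCompact ((Icc (-1 : ℝ) 1) ×ˢ (Icc (-1 : ℝ) 1))).of_isClosed_subset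
    circ_closed fun p hp => ⟨circ_fst hp, circ_snd hp⟩

lemma sqrt_abs {x y : ℝ} (h : x ^ 2 + y ^ 2 = 1) : √(1 - y ^ 2) = x ∨ √(1 - y ^ 2) = -x := by
  have : 1 - y ^ 2 = x ^ 2 := by linarith
  rw [this, Real.sqrt_sq_eq_abs]
  rcases abs_choice x with h | h
  · exact Or.inl h
  · exact Or.inr h

lemma beta_cT {β : ℝ × ℝ → Sph} (hβ : IsBetaPath β) {p : ℝ × ℝ} (hp : p ∈ circS) : β (cT p.2) = β p :=
  (hβ.2 _ (cT_mem (circ_snd hp)) _ hp).2 ⟨sqrt_abs hp, rfl⟩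

lemma alpha_cA {α : ℝ × ℝ → Sph} (hα : IsAlphaPath α) {p : ℝ × ℝ} (hp : p ∈ circS) : α (cA p.1) = α p :=
  (hα.2 _ (cA_mem (circ_fst hp)) _ hp).2 ⟨rfl, sqrt_abs (x := p.2) (y := p.1) (by
    have : p.1 ^ 2 + p.2 ^ 2 = 1 := hp
    linarith)⟩

lemma beta_arc {β : ℝ × ℝ → Sph} (hβ : IsBetaPath β) :
    ContinuousOn (fun t => β (cT t)) (Icc (-1) 1) ∧ InjOn (fun t => β (cT t)) (Icc (-1) 1) ∧
      pathIm β = (fun t => β (cT t)) '' Icc (-1) 1 := by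
  refine ⟨hβ.1.comp (by unfold cT; fun_prop) (fun t ht => cT_mem ht), ?_, ?_⟩
  · intro s hs t ht h
    exact ((hβ.2 _ (cT_mem hs) _ (cT_mem ht)).1 h).2
  · ext x; constructor
    · rintro ⟨p, hp, rfl⟩
      exact ⟨p.2, circ_snd hp, beta_cT hβ hp⟩
    · rintro ⟨t, ht, rfl⟩
      exact ⟨_, cT_mem ht, rfl⟩

lemma alpha_arc {α : ℝ × ℝ → Sph} (hα : IsAlphaPath α) :
    ContinuousOn (fun t => α (cA t)) (Icc (-1) 1) ∧ InjOn (fun t => α (cA t)) (Icc (-1) 1) ∧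
      pathIm α = (fun t => α (cA t)) '' Icc (-1) 1 := by
  refine ⟨hα.1.comp (by unfold cA; fun_prop) (fun t ht => cA_mem ht), ?_, ?_⟩
  · intro s hs t ht h
    exact ((hα.2 _ (cA_mem hs) _ (cA_mem ht)).1 h).1
  · ext x; constructor
    · rintro ⟨p, hp, rfl⟩
      exact ⟨p.1, circ_fst hp, alpha_cA hα hp⟩
    · rintro ⟨t, ht, rfl⟩
      exact ⟨_, cA_mem ht, rfl⟩

lemma dense_compl_fam {A : Set (ℝ × ℝ → Sph)} (hA : A.Countable)
    (h : ∀ α ∈ A, IsClosed (pathIm α) ∧ interior (pathIm α) = ∅) : Dense (famIm A)ᶜ := by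
  unfold famIm
  rw [compl_iUnion₂]
  exact dense_biInter_of_isOpen (fun α hα => (h α hα).1.isOpen_compl) hA
    (fun α hα => interior_eq_empty_iff_dense_compl.1 (h α hα).2)

lemma alpha_closed {α : ℝ × ℝ → Sph} (hα : IsAlphaPath α) : IsClosed (pathIm α) :=
  (circ_compact.image_of_continuousOn hα.1).isClosed

lemma beta_closed {α : ℝ × ℝ → Sph} (hα : IsBetaPath α) : IsClosed (pathIm α) :=
  (circ_compact.image_of_continuousOn hα.1).isClosed

lemma alpha_preconn {α : ℝ × ℝ → Sph} (hα : IsAlphaPath α) : IsPreconnected (pathIm α) := by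
  rw [(alpha_arc hα).2.2]
  exact isPreconnected_Icc.image _ (alpha_arc hα).1

lemma pathIm_ne (α : ℝ × ℝ → Sph) : (pathIm α).Nonempty := ⟨α (1, 0), (1, 0), by simp [circS], rfl⟩

lemma dense_alpha {A : Set (ℝ × ℝ → Sph)} (hA : A.Countable) (h : ∀ α ∈ A, IsAlphaPath α) :
    Dense (famIm A)ᶜ := dense_compl_fam hA fun α hα => ⟨alpha_closed (h α hα), by
      have := alpha_arc (h α hα)
      rw [this.2.2]; exact arc_interior this.1 this.2.1 (by norm_num)⟩

lemma dense_beta {A : Set (ℝ × ℝ → Sph)} (hA : A.Countable) (h : ∀ α ∈ A, IsBetaPath α) :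
    Dense (famIm A)ᶜ := dense_compl_fam hA fun α hα => ⟨beta_closed (h α hα), by
      have := beta_arc (h α hα)
      rw [this.2.2]; exact arc_interior this.1 this.2.1 (by norm_num)⟩

def pbar (p : ℝ × ℝ) : ℝ × ℝ := (p.1, -p.2)

lemma pbar_mem {p : ℝ × ℝ} (hp : p ∈ circS) : pbar p ∈ circS := by
  have : p.1 ^ 2 + p.2 ^ 2 = 1 := hp
  show p.1 ^ 2 + (-p.2) ^ 2 = 1
  rw [neg_sq]; exact this

def gamU (A : Set (ℝ × ℝ → Sph)) (Φ : Sph → Sph) : Set (Sph × Sph) := (fun x => (x, Φ x)) '' (famIm A)ᶜ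
def Gam (A : Set (ℝ × ℝ → Sph)) (Φ : Sph → Sph) : Set (Sph × Sph) := closure (gamU A Φ)
def GamG (f : Sph → Sph) (A : Set (ℝ × ℝ → Sph)) (Φ : Sph → Sph) : Set (Sph × Sph) :=
  closure ((fun x => (Φ x, Φ (f x))) '' (famIm A)ᶜ)

structure Setup (f : Sph → Sph) (A B : Set (ℝ × ℝ → Sph)) (ext : (ℝ × ℝ → Sph) → OP → Sph)
    (b : (ℝ × ℝ → Sph) → ℝ × ℝ → Sph) (Φ : Sph → Sph) : Prop where
  hf : Continuous f
  hA : A.Countable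
  hstable : FStable f A
  hdata : RegluingData A ext B b
  hreg : IsRegluing A ext B b Φ

lemma deltaBar_closed : IsClosed deltaBar := by
  have : deltaBar = ((fun p : ℝ × ℝ => (p : OP)) '' {p | p.1 ^ 2 + p.2 ^ 2 < 1})ᶜ := by
    ext z
    induction z using OnePoint.rec with
    | infty => simp [deltaBar]
    | coe p => simp [deltaBar]
  rw [this]
  exact ((OnePoint.isOpen_image_coe).2 (isOpen_lt (by fun_prop) continuous_const)).isClosed_compl

lemma deltaInf_open : IsOpen deltaInf := by
  have : deltaInf = ((fun p : ℝ × ℝ => (p : OP)) '' {p | p.1 ^ 2 + p.2 ^ 2 ≤ 1})ᶜ := by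
    ext z
    induction z using OnePoint.rec with
    | infty => simp [deltaInf, deltaBar, circOP]
    | coe p =>
      simp [deltaInf, deltaBar, circOP, circS]
      constructor
      · rintro ⟨h1, h2⟩; exact lt_of_le_of_ne h1 (Ne.symm h2)
      · intro h; exact ⟨h.le, h.ne'⟩
  rw [this]
  refine IsClosed.isOpen_compl (self := ?_)
  have hc : IsCompact {p : ℝ × ℝ | p.1 ^ 2 + p.2 ^ 2 ≤ 1} := by
    refine (isCompact_Icc.prod isCompact_Icc : IsCompact ((Icc (-1 : ℝ) 1) ×ˢ (Icc (-1 : ℝ) 1))).of_isClosed_subset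
      (isClosed_le (by fun_prop) continuous_const) fun p hp => ?_
    have h : p.1 ^ 2 + p.2 ^ 2 ≤ 1 := hp
    refine ⟨⟨?_, ?_⟩, ?_, ?_⟩ <;> nlinarith [sq_nonneg p.1, sq_nonneg p.2]
  exact (hc.image OnePoint.continuous_coe).isClosed

lemma circ_closure {p : ℝ × ℝ} (hp : p ∈ circS) : (p : OP) ∈ closure deltaInf := by
  have h1 : Tendsto (fun r : ℝ => ((r • p : ℝ × ℝ) : OP)) (𝓝[>] 1) (𝓝 (p : OP)) := by
    have : Continuous (fun r : ℝ => ((r • p : ℝ × ℝ) : OP)) :=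
      OnePoint.continuous_coe.comp (by fun_prop)
    have := this.tendsto 1
    rw [one_smul] at this
    exact this.mono_left nhdsWithin_le_nhds
  refine mem_closure_of_tendsto h1 ?_
  filter_upwards [self_mem_nhdsWithin] with r hr
  have hr : (1 : ℝ) < r := hr
  have hp : p.1 ^ 2 + p.2 ^ 2 = 1 := hp
  have : 1 < (r • p).1 ^ 2 + (r • p).2 ^ 2 := by
    simp only [Prod.smul_fst, Prod.smul_snd, smul_eq_mul]
    have : (r * p.1) ^ 2 + (r * p.2) ^ 2 = r ^ 2 := by
      rw [mul_pow, mul_pow, ← mul_add, hp, mul_one]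
    rw [this]; nlinarith
  refine ⟨Or.inr ⟨_, this.le, rfl⟩, ?_⟩
  rintro ⟨q, hq, hqe⟩
  have : q = r • p := OnePoint.coe_injective hqe
  rw [this] at hq
  have : (r • p).1 ^ 2 + (r • p).2 ^ 2 = 1 := hq
  linarith

lemma circ_deltaBar {p : ℝ × ℝ} (hp : p ∈ circS) : (p : OP) ∈ deltaBar :=
  Or.inr ⟨p, (show p.1 ^ 2 + p.2 ^ 2 = 1 from hp).ge, rfl⟩

lemma ext_open {α : ℝ × ℝ → Sph} {ext : OP → Sph} (hα : IsAlphaPath α) (h : IsExtension α ext)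
    {O : Set OP} (hO : IsOpen O) : IsOpen (ext '' (O ∩ deltaInf)) := by
  have hoe : IsOpenEmbedding (deltaInf.restrict ext) := ⟨h.2.2.1, by
    have hr : range (deltaInf.restrict ext) = ext '' deltaInf := by rw [image_eq_range]; rfl
    rw [hr, h.2.2.2]; exact (alpha_closed hα).isOpen_compl⟩
  have := hoe.isOpenMap _ (hO.preimage continuous_subtype_val)
  convert this using 1
  ext x; constructor
  · rintro ⟨z, ⟨hz, hz'⟩, rfl⟩; exact ⟨⟨z, hz'⟩, hz, rfl⟩
  · rintro ⟨⟨z, hz'⟩, hz, rfl⟩; exact ⟨z, ⟨hz, hz'⟩, rfl⟩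

section
variable {f : Sph → Sph} {A B : Set (ℝ × ℝ → Sph)} {ext : (ℝ × ℝ → Sph) → OP → Sph}
    {b : (ℝ × ℝ → Sph) → ℝ × ℝ → Sph} {Φ : Sph → Sph}

lemma not_fam {α : ℝ × ℝ → Sph} (hα : α ∈ A) {p : ℝ × ℝ} (hp : p ∈ circS) : α p ∈ famIm A :=
  mem_iUnion₂.2 ⟨α, hα, p, hp, rfl⟩

lemma L3 (S : Setup f A B ext b Φ) {α : ℝ × ℝ → Sph} (hα : α ∈ A) {p : ℝ × ℝ} (hp : p ∈ circS) :
    (α p, b α p) ∈ Gam A Φ := by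
  have hal := S.hdata.alpha α hα
  have hex := S.hdata.extOk α hα
  have hcl : (p : OP) ∈ closure (deltaInf ∩ ext α ⁻¹' (famIm A)ᶜ) := by
    rw [mem_closure_iff]
    intro O hO hpO
    obtain ⟨z, hzO, hz⟩ := mem_closure_iff.1 (circ_closure hp) O hO hpO
    obtain ⟨_, ⟨w, ⟨hw, hw'⟩, rfl⟩, hU⟩ := (dense_alpha S.hA S.hdata.alpha).inter_open_nonempty _ (ext_open hal hex hO)
      ⟨_, z, ⟨hzO, hz⟩, rfl⟩
    exact ⟨w, hw, hw', hU⟩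
  have := mem_closure_iff_nhdsWithin_neBot.1 hcl
  have h1 : Tendsto (ext α) (𝓝[deltaInf ∩ ext α ⁻¹' (famIm A)ᶜ] (p : OP)) (𝓝 (α p)) := by
    have := hex.1 (p : OP) (circ_deltaBar hp)
    rw [ContinuousWithinAt, hex.2.1 p hp] at this
    exact this.mono_left (nhdsWithin_mono _ fun z hz => hz.1.1)
  have h2 := S.hreg.tendsto α hα p hp
  refine mem_closure_of_tendsto (h1.prodMk_nhds h2) ?_
  filter_upwards [self_mem_nhdsWithin] with z hz
  exact ⟨_, hz.2, rfl⟩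

lemma L4a (S : Setup f A B ext b Φ) {α : ℝ × ℝ → Sph} (hα : α ∈ A) {p : ℝ × ℝ} (hp : p ∈ circS)
    {O : Set Sph} (hO : O ∈ 𝓝 (b α p)) :
    ∃ M ∈ 𝓝 (p : OP), ∀ z ∈ M, z ∈ deltaInf → ∀ v, (ext α z, v) ∈ Gam A Φ → v ∈ O := by
  have hal := S.hdata.alpha α hα
  have hex := S.hdata.extOk α hα
  obtain ⟨O', hO', hO'c, hO'O⟩ := exists_mem_nhds_isClosed_subset hO
  obtain ⟨M, hM, hMp, hMO⟩ := mem_nhdsWithin.1 (S.hreg.tendsto α hα p hp hO')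
  refine ⟨M, hM.mem_nhds hMp, fun z hz hz' v hv => hO'O ?_⟩
  have hW := ext_open hal hex hM
  have hzW : ext α z ∈ ext α '' (M ∩ deltaInf) := ⟨z, ⟨hz, hz'⟩, rfl⟩
  have h1 : (ext α z, v) ∈ closure (gamU A Φ ∩ (ext α '' (M ∩ deltaInf)) ×ˢ univ) := by
    rw [mem_closure_iff]
    intro Q hQ hQm
    obtain ⟨w, hw, hw'⟩ := mem_closure_iff.1 hv (Q ∩ (ext α '' (M ∩ deltaInf)) ×ˢ univ)
      (hQ.inter (hW.prod isOpen_univ)) ⟨hQm, hzW, trivial⟩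
    exact ⟨w, hw.1, hw', hw.2⟩
  have h2 : closure (gamU A Φ ∩ (ext α '' (M ∩ deltaInf)) ×ˢ univ) ⊆ univ ×ˢ O' := by
    refine closure_minimal ?_ (isClosed_univ.prod hO'c)
    rintro _ ⟨⟨x, hx, rfl⟩, ⟨w, ⟨hw, hw'⟩, hwx⟩, -⟩
    refine ⟨trivial, ?_⟩
    have := hMO ⟨hw, hw', by rw [mem_preimage]; simp only at hwx; rw [hwx]; exact hx⟩
    simp only [mem_preimage] at this
    simp only at hwx
    rwa [hwx] at this
  exact (h2 h1).2

lemma LL (S : Setup f A B ext b Φ) {α : ℝ × ℝ → Sph} (hα : α ∈ A) {T : Type} (𝒰 : Ultrafilter T)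
    (x : T → Sph) (hx : ∀ᶠ t in (𝒰 : Filter T), x t ∉ pathIm α) {x0 : Sph} (hx0 : x0 ∈ pathIm α)
    (hlim : Tendsto x 𝒰 (𝓝 x0)) :
    ∃ p ∈ circS, x0 = α p ∧ ∀ v : T → Sph, (∀ᶠ t in (𝒰 : Filter T), (x t, v t) ∈ Gam A Φ) →
      Tendsto v 𝒰 (𝓝 (b α p)) := by
  have hex := S.hdata.extOk α hα
  have h1 : ∀ y, y ∉ pathIm α → ∃ z, z ∈ deltaInf ∧ ext α z = y := by
    intro y hy
    have : y ∈ ext α '' deltaInf := by rw [hex.2.2.2]; exact hy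
    exact this
  choose! ζ hζ hζ' using h1
  have hbar : ∀ᶠ t in (𝒰 : Filter T), ζ (x t) ∈ deltaBar := hx.mono fun t ht => (hζ _ ht).1
  obtain ⟨w, hwB, hw⟩ := deltaBar_closed.isCompact.ultrafilter_le_nhds (𝒰.map (ζ ∘ x)) (le_principal_iff.2 hbar)
  have hw : Tendsto (fun t => ζ (x t)) 𝒰 (𝓝 w) := hw
  have hw2 : Tendsto (fun t => ζ (x t)) 𝒰 (𝓝[deltaBar] w) := tendsto_nhdsWithin_iff.2 ⟨hw, hbar⟩
  have h3 : Tendsto (fun t => ext α (ζ (x t))) 𝒰 (𝓝 (ext α w)) := (hex.1 w hwB).tendsto.comp hw2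
  have h4 : ext α w = x0 := tendsto_nhds_unique (h3.congr' (hx.mono fun t ht => hζ' _ ht)) hlim
  have hwc : w ∈ circOP := by
    by_contra h
    have : ext α w ∈ ext α '' deltaInf := ⟨w, ⟨hwB, h⟩, rfl⟩
    rw [hex.2.2.2, h4] at this
    exact this hx0
  obtain ⟨p, hp, rfl⟩ := hwc
  refine ⟨p, hp, by rw [← h4]; exact hex.2.1 p hp, fun v hv => ?_⟩
  intro O hO
  obtain ⟨M, hM, h⟩ := L4a S hα hp hO
  show ∀ᶠ t in (𝒰 : Filter T), v t ∈ O
  filter_upwards [hw hM, hx, hv] with t t1 t2 t3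
  exact h _ t1 (hζ _ t2) _ (by rwa [hζ' _ t2])

lemma L1 (S : Setup f A B ext b Φ) {x v : Sph} (h : (x, v) ∈ Gam A Φ) :
    (x ∈ (famIm A)ᶜ ∧ v = Φ x) ∨ ∃ α ∈ A, ∃ p ∈ circS, x = α p ∧ v = b α p := by
  obtain ⟨𝒰, hG, hlim⟩ := mem_closure_iff_ultrafilter.1 h
  have l1 : Tendsto Prod.fst (𝒰 : Filter (Sph × Sph)) (𝓝 x) := (continuous_fst.tendsto (x, v)).mono_left hlim
  have l2 : Tendsto Prod.snd (𝒰 : Filter (Sph × Sph)) (𝓝 v) := (continuous_snd.tendsto (x, v)).mono_left hlim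
  have hG' : ∀ᶠ q in (𝒰 : Filter (Sph × Sph)), q ∈ gamU A Φ := hG
  have hU : ∀ᶠ q in (𝒰 : Filter (Sph × Sph)), q.1 ∈ (famIm A)ᶜ ∧ q.2 = Φ q.1 := by
    filter_upwards [hG'] with q hq
    obtain ⟨y, hy, rfl⟩ := hq
    exact ⟨hy, rfl⟩
  by_cases hx : x ∈ (famIm A)ᶜ
  · left
    refine ⟨hx, ?_⟩
    have : Tendsto (fun q : Sph × Sph => Φ q.1) (𝒰 : Filter (Sph × Sph)) (𝓝 (Φ x)) :=
      (S.hreg.contOn x hx).tendsto.comp (tendsto_nhdsWithin_iff.2 ⟨l1, hU.mono fun q hq => hq.1⟩)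
    exact tendsto_nhds_unique l2 (this.congr' (hU.mono fun q hq => hq.2.symm))
  · right
    have hx : x ∈ famIm A := not_not.1 hx
    obtain ⟨α, hα, hxα⟩ := mem_iUnion₂.1 hx
    obtain ⟨p, hp, hxp, hv⟩ := LL S hα 𝒰 Prod.fst (hU.mono fun q hq hq' => hq.1 (mem_iUnion₂.2 ⟨α, hα, hq'⟩)) hxα l1
    refine ⟨α, hα, p, hp, hxp, ?_⟩
    exact tendsto_nhds_unique l2 (hv Prod.snd (hG'.mono fun q hq => subset_closure hq))

lemma back (S : Setup f A B ext b Φ) {x : Sph} (hx : x ∈ (famIm A)ᶜ) : f x ∈ (famIm A)ᶜ :=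
  fun h => hx (S.hstable.2 h)

lemma L2 (S : Setup f A B ext b Φ) {y v : Sph} (h : (y, v) ∈ GamG f A Φ) :
    ∃ x, (x, y) ∈ Gam A Φ ∧ (f x, v) ∈ Gam A Φ := by
  obtain ⟨𝒰, hG, hlim⟩ := mem_closure_iff_ultrafilter.1 h
  have l1 : Tendsto Prod.fst (𝒰 : Filter (Sph × Sph)) (𝓝 y) := (continuous_fst.tendsto (y, v)).mono_left hlim
  have l2 : Tendsto Prod.snd (𝒰 : Filter (Sph × Sph)) (𝓝 v) := (continuous_snd.tendsto (y, v)).mono_left hlim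
  have hG' : ∀ᶠ q in (𝒰 : Filter (Sph × Sph)), q ∈ (fun x => (Φ x, Φ (f x))) '' (famIm A)ᶜ := hG
  have hch : ∀ q, q ∈ (fun x => (Φ x, Φ (f x))) '' (famIm A)ᶜ → ∃ x, x ∈ (famIm A)ᶜ ∧ (Φ x, Φ (f x)) = q :=
    fun q hq => hq
  have : Nonempty Sph := ⟨y⟩
  choose! ξ h1 h2 using hch
  obtain ⟨x0, -, hx0⟩ := isCompact_univ.ultrafilter_le_nhds (𝒰.map ξ) (by simp)
  have hx0 : Tendsto ξ (𝒰 : Filter (Sph × Sph)) (𝓝 x0) := hx0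
  refine ⟨x0, mem_closure_of_tendsto (hx0.prodMk_nhds l1) ?_,
    mem_closure_of_tendsto (((S.hf.tendsto x0).comp hx0).prodMk_nhds l2) ?_⟩
  · filter_upwards [hG'] with q hq
    exact ⟨ξ q, h1 q hq, by
      have := congrArg Prod.fst (h2 q hq)
      simp only at this
      simp [this]⟩
  · filter_upwards [hG'] with q hq
    exact ⟨f (ξ q), back S (h1 q hq), by
      have := congrArg Prod.snd (h2 q hq)
      simp only at this
      simp [this]⟩

end

section
variable {f : Sph → Sph} {A B : Set (ℝ × ℝ → Sph)} {ext : (ℝ × ℝ → Sph) → OP → Sph}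
    {b : (ℝ × ℝ → Sph) → ℝ × ℝ → Sph} {Φ : Sph → Sph}

lemma alpha_eq (S : Setup f A B ext b Φ) {α α' : ℝ × ℝ → Sph} (hα : α ∈ A) (hα' : α' ∈ A) {p q : ℝ × ℝ}
    (hp : p ∈ circS) (hq : q ∈ circS) (h : α p = α' q) : α = α' := by
  by_contra hne
  exact disjoint_left.1 (S.hdata.disjA hα hα' hne) ⟨p, hp, rfl⟩ ⟨q, hq, h.symm⟩

lemma b_eq (S : Setup f A B ext b Φ) {α α' : ℝ × ℝ → Sph} (hα : α ∈ A) (hα' : α' ∈ A) {p q : ℝ × ℝ}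
    (hp : p ∈ circS) (hq : q ∈ circS) (h : b α p = b α' q) : α = α' := by
  apply S.hdata.bij.injOn hα hα'
  by_contra hne
  exact disjoint_left.1 (S.hdata.disjB (S.hdata.bij.mapsTo hα) (S.hdata.bij.mapsTo hα') hne)
    ⟨p, hp, rfl⟩ ⟨q, hq, h.symm⟩

lemma gvalU (S : Setup f A B ext b Φ) {x v : Sph} (hx : x ∈ (famIm A)ᶜ) (h : (x, v) ∈ Gam A Φ) : v = Φ x := by
  rcases L1 S h with h | ⟨α, hα, p, hp, rfl, -⟩
  · exact h.2
  · exact absurd (not_fam hα hp) hx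

lemma betaB (S : Setup f A B ext b Φ) {α : ℝ × ℝ → Sph} (hα : α ∈ A) : IsBetaPath (b α) :=
  S.hdata.beta _ (S.hdata.bij.mapsTo hα)

lemma circ_rel {p q : ℝ × ℝ} (hp : p ∈ circS) (hq : q ∈ circS) (h : q.2 = p.2 ∨ q.2 = -p.2) :
    q.1 = p.1 ∨ q.1 = -p.1 := by
  have h1 : p.1 ^ 2 + p.2 ^ 2 = 1 := hp
  have h2 : q.1 ^ 2 + q.2 ^ 2 = 1 := hq
  apply sq_eq_sq_iff_eq_or_eq_neg.1
  rcases h with h | h <;> rw [h] at h2 <;> linarith [neg_sq p.2]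

lemma b_val (S : Setup f A B ext b Φ) {α : ℝ × ℝ → Sph} (hα : α ∈ A) {p q : ℝ × ℝ} (hp : p ∈ circS)
    (hq : q ∈ circS) (h : q.2 = p.2) : b α q = b α p :=
  ((betaB S hα).2 q hq p hp).2 ⟨circ_rel hp hq (Or.inl h), h⟩

lemma gval (S : Setup f A B ext b Φ) {α : ℝ × ℝ → Sph} (hα : α ∈ A) {p : ℝ × ℝ} (hp : p ∈ circS) {v : Sph}
    (h : (α p, v) ∈ Gam A Φ) : v = b α p ∨ v = b α (pbar p) := by
  rcases L1 S h with h | ⟨α', hα', q, hq, h1, h2⟩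
  · exact absurd (not_fam hα hp) h.1
  · have := alpha_eq S hα hα' hp hq h1
    subst this
    obtain ⟨h3, h4⟩ := ((S.hdata.alpha α hα).2 p hp q hq).1 h1
    rcases h4 with h4 | h4
    · left; rw [h2]; exact b_val S hα hp hq h4.symm
    · right; rw [h2]; exact b_val S hα (pbar_mem hp) hq (by simp [pbar, h4])

lemma L1' (S : Setup f A B ext b Φ) {x x' y : Sph} (h : (x, y) ∈ Gam A Φ) (h' : (x', y) ∈ Gam A Φ) :
    (x ∈ (famIm A)ᶜ ∧ x' = x) ∨ ∃ α ∈ A, ∃ p ∈ circS, ∃ p' ∈ circS, x = α p ∧ y = b α p ∧ x' = α p' ∧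
      (p'.1 = p.1 ∨ p'.1 = -p.1) ∧ p'.2 = p.2 := by
  have key : ∀ {x} {α : ℝ × ℝ → Sph} {p}, x ∈ (famIm A)ᶜ → α ∈ A → p ∈ circS → Φ x ≠ b α p := by
    intro x α p hx hα hp he
    exact S.hreg.bijOn.mapsTo hx (he ▸ not_fam (S.hdata.bij.mapsTo hα) hp)
  rcases L1 S h with ⟨hx, hy⟩ | ⟨α, hα, p, hp, hx, hy⟩
  · rcases L1 S h' with ⟨hx', hy'⟩ | ⟨α', hα', p', hp', hx', hy'⟩
    · exact Or.inl ⟨hx, S.hreg.bijOn.injOn hx' hx (hy'.symm.trans hy)⟩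
    · exact absurd (hy.symm.trans hy') (key hx hα' hp')
  · rcases L1 S h' with ⟨hx', hy'⟩ | ⟨α', hα', p', hp', hx', hy'⟩
    · exact absurd (hy'.symm.trans hy) (key hx' hα hp)
    · have := b_eq S hα' hα hp' hp (hy'.symm.trans hy)
      subst this
      obtain ⟨h1, h2⟩ := ((betaB S hα).2 p' hp' p hp).1 (hy'.symm.trans hy)
      exact Or.inr ⟨α', hα, p, hp, p', hp', hx, hy, hx', h1, h2⟩

lemma L5 (S : Setup f A B ext b Φ) {y v v' : Sph} (h : (y, v) ∈ GamG f A Φ) (h' : (y, v') ∈ GamG f A Φ)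
    (hne : v ≠ v') : ∃ α ∈ A, ∃ α' ∈ A, (∀ p ∈ circS, f (α p) = α' p) ∧ ∃ p ∈ circS, p.2 ≠ 0 ∧ y = b α p ∧
      ((v = b α' p ∧ v' = b α' (pbar p)) ∨ (v = b α' (pbar p) ∧ v' = b α' p)) := by
  obtain ⟨x, hx1, hx2⟩ := L2 S h
  obtain ⟨x', hx1', hx2'⟩ := L2 S h'
  rcases L1' S hx1 hx1' with ⟨hx, rfl⟩ | ⟨α, hα, p, hp, p', hp', rfl, hy, rfl, hpp, hpp2⟩
  · exact absurd ((gvalU S (back S hx) hx2).trans (gvalU S (back S hx) hx2').symm) hne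
  · rcases S.hstable.1 α hα with ⟨α', hα', hff⟩ | ⟨hff, hdis⟩
    · refine ⟨α, hα, α', hα', hff, p, hp, ?_⟩
      rw [hff p hp] at hx2
      rw [hff p' hp'] at hx2'
      have e1 : b α' p' = b α' p := b_val S hα' hp hp' hpp2
      have e2 : b α' (pbar p') = b α' (pbar p) := b_val S hα' (pbar_mem hp) (pbar_mem hp') (by simp [pbar, hpp2])
      have g1 := gval S hα' hp hx2
      have g2 := gval S hα' hp' hx2'
      rw [e1, e2] at g2
      have hp2 : p.2 ≠ 0 := by
        intro h0
        have : b α' (pbar p) = b α' p := b_val S hα' hp (pbar_mem hp) (by simp [pbar, h0])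
        rw [this] at g1 g2
        apply hne
        rw [g1.elim id id, g2.elim id id]
      refine ⟨hp2, hy, ?_⟩
      rcases g1 with g1 | g1 <;> rcases g2 with g2 | g2
      · exact absurd (g1.trans g2.symm) hne
      · exact Or.inl ⟨g1, g2⟩
      · exact Or.inr ⟨g1, g2⟩
      · exact absurd (g1.trans g2.symm) hne
    · exfalso
      have hfe : f (α p') = f (α p) := by
        rcases hpp with h1 | h1
        · have : p' = p := Prod.ext h1 hpp2
          rw [this]
        · have : p' = (-p.1, p.2) := Prod.ext h1 hpp2
          rw [this]; exact (hff p hp).symm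
      have hU : f (α p) ∈ (famIm A)ᶜ := fun hm => disjoint_left.1 hdis ⟨_, ⟨p, hp, rfl⟩, rfl⟩ hm
      rw [hfe] at hx2'
      exact hne ((gvalU S hU hx2).trans (gvalU S hU hx2').symm)

lemma GamG_closed : IsClosed (GamG f A Φ) := isClosed_closure
lemma Gam_closed : IsClosed (Gam A Φ) := isClosed_closure

lemma GamG_ne (S : Setup f A B ext b Φ) (y : Sph) : ∃ v, (y, v) ∈ GamG f A Φ := by
  have hB : B.Countable := by
    rw [← S.hdata.bij.image_eq]; exact S.hA.image b
  have hd := dense_beta hB S.hdata.beta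
  have hc : IsClosed (Prod.fst '' GamG f A Φ) := (GamG_closed.isCompact.image continuous_fst).isClosed
  have : closure (famIm B)ᶜ ⊆ Prod.fst '' GamG f A Φ := by
    refine closure_minimal ?_ hc
    intro y hy
    obtain ⟨x, hx, rfl⟩ := S.hreg.bijOn.surjOn hy
    exact ⟨_, subset_closure ⟨x, hx, rfl⟩, rfl⟩
  rw [hd.closure_eq] at this
  obtain ⟨⟨_, v⟩, h, rfl⟩ := this (mem_univ y)
  exact ⟨v, h⟩

lemma finish (S : Setup f A B ext b Φ)
    (huniq : ∀ y v v', (y, v) ∈ GamG f A Φ → (y, v') ∈ GamG f A Φ → v = v') :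
    ∃ g : Sph → Sph, Continuous g ∧ ∀ x ∈ (famIm A)ᶜ, g (Φ x) = Φ (f x) := by
  choose g hg using GamG_ne S
  refine ⟨g, ?_, fun x hx => huniq _ _ _ (hg _) (subset_closure ⟨x, hx, rfl⟩)⟩
  rw [continuous_iff_isClosed]
  intro C hC
  have : g ⁻¹' C = Prod.fst '' (GamG f A Φ ∩ univ ×ˢ C) := by
    ext y; constructor
    · intro hy; exact ⟨(y, g y), ⟨hg y, trivial, hy⟩, rfl⟩
    · rintro ⟨⟨_, v⟩, ⟨h1, -, h2⟩, rfl⟩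
      have := huniq _ _ _ (hg _) h1
      show g _ ∈ C
      rw [this]; exact h2
  rw [this]
  exact ((GamG_closed.inter (isClosed_univ.prod hC)).isCompact.image continuous_fst).isClosed

end

lemma pbar_cT (s : ℝ) : pbar (cT s) = cT (-s) := by
  simp [pbar, cT]

lemma neg_Icc {s : ℝ} (hs : s ∈ Icc (-1 : ℝ) 1) : -s ∈ Icc (-1 : ℝ) 1 := ⟨by linarith [hs.2], by linarith [hs.1]⟩

section
variable {f : Sph → Sph} {A B : Set (ℝ × ℝ → Sph)} {ext : (ℝ × ℝ → Sph) → OP → Sph}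
    {b : (ℝ × ℝ → Sph) → ℝ × ℝ → Sph} {Φ : Sph → Sph}

lemma L5' (S : Setup f A B ext b Φ) {y v v' : Sph} (h : (y, v) ∈ GamG f A Φ) (h' : (y, v') ∈ GamG f A Φ)
    (hne : v ≠ v') : ∃ α ∈ A, ∃ α' ∈ A, (∀ p ∈ circS, f (α p) = α' p) ∧ ∃ s ∈ Icc (-1 : ℝ) 1, s ≠ 0 ∧
      y = b α (cT s) ∧
      ((v = b α' (cT s) ∧ v' = b α' (cT (-s))) ∨ (v = b α' (cT (-s)) ∧ v' = b α' (cT s))) := by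
  obtain ⟨α, hα, α', hα', hff, p, hp, hp2, hy, hv⟩ := L5 S h h' hne
  have e0 : b α p = b α (cT p.2) := (beta_cT (betaB S hα) hp).symm
  have e1 : b α' p = b α' (cT p.2) := (beta_cT (betaB S hα') hp).symm
  have e2 : b α' (pbar p) = b α' (cT (-p.2)) := (beta_cT (betaB S hα') (pbar_mem hp)).symm
  rw [e1, e2] at hv
  rw [e0] at hy
  exact ⟨α, hα, α', hα', hff, p.2, circ_snd hp, hp2, hy, hv⟩

def NN (f : Sph → Sph) (A : Set (ℝ × ℝ → Sph)) (a : ℝ × ℝ → Sph) : Set (ℝ × ℝ → Sph) :=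
  {α | α ∈ A ∧ ∀ p ∈ circS, f (α p) = a p}

def BT (f : Sph → Sph) (A : Set (ℝ × ℝ → Sph)) (b : (ℝ × ℝ → Sph) → ℝ × ℝ → Sph) (Φ : Sph → Sph)
    (a α : ℝ × ℝ → Sph) (s : ℝ) : Prop :=
  (b α (cT s), b a (cT s)) ∈ GamG f A Φ ∧ (b α (cT s), b a (cT (-s))) ∈ GamG f A Φ

def Bd (f : Sph → Sph) (A : Set (ℝ × ℝ → Sph)) (b : (ℝ × ℝ → Sph) → ℝ × ℝ → Sph) (Φ : Sph → Sph)
    (a : ℝ × ℝ → Sph) (y : Sph) : Prop :=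
  ∃ α ∈ NN f A a, ∃ s ∈ Icc (-1 : ℝ) 1, s ≠ 0 ∧ y = b α (cT s) ∧ BT f A b Φ a α s

lemma NN_union (S : Setup f A B ext b Φ) {a : ℝ × ℝ → Sph} (ha : a ∈ A) :
    ⋃ α ∈ NN f A a, pathIm α = f ⁻¹' pathIm a := by
  ext x; constructor
  · intro hx
    obtain ⟨α, hα, p, hp, rfl⟩ := mem_iUnion₂.1 hx
    exact ⟨p, hp, (hα.2 p hp).symm⟩
  · rintro ⟨q, hq, hx⟩
    have h1 : f x ∈ famIm A := hx ▸ not_fam ha hq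
    obtain ⟨α, hα, p, hp, rfl⟩ := mem_iUnion₂.1 (S.hstable.2 h1)
    rcases S.hstable.1 α hα with ⟨α', hα', hff⟩ | ⟨-, hdis⟩
    · have : a = α' := alpha_eq S ha hα' hq hp (hx.trans (hff p hp))
      subst this
      exact mem_iUnion₂.2 ⟨α, ⟨hα, hff⟩, p, hp, rfl⟩
    · exact absurd h1 (disjoint_left.1 hdis ⟨_, ⟨p, hp, rfl⟩, rfl⟩)

lemma inv_arc (S : Setup f A B ext b Φ) {α : ℝ × ℝ → Sph} (hα : α ∈ A) {q : ℝ × ℝ} (hq : q ∈ circS) {x : Sph}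
    (h : (x, b α q) ∈ Gam A Φ) : ∃ p ∈ circS, x = α p ∧ p.2 = q.2 := by
  rcases L1' S (L3 S hα hq) h with ⟨h1, -⟩ | ⟨α', hα', p, hp, p', hp', h1, h2, h3, h4, h5⟩
  · exact absurd (not_fam hα hq) h1
  · have := alpha_eq S hα hα' hq hp h1
    subst this
    have := ((betaB S hα).2 q hq p hp).1 h2
    exact ⟨p', hp', h3, h5.trans this.2.symm⟩

lemma isol (S : Setup f A B ext b Φ) {a : ℝ × ℝ → Sph} (ha : a ∈ A) (hbad : ∃ y, Bd f A b Φ a y) :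
    ∃ α ∈ NN f A a, (∃ s ∈ Icc (-1 : ℝ) 1, s ≠ 0 ∧ BT f A b Φ a α s) ∧
      ∀ s ∈ Icc (-1 : ℝ) 1, {y | Bd f A b Φ a y → y ∈ pathIm (b α)} ∈ 𝓝 (b α (cT s)) := by
  let Nb : Set (ℝ × ℝ → Sph) := {α | α ∈ NN f A a ∧ ∃ s ∈ Icc (-1 : ℝ) 1, s ≠ 0 ∧ BT f A b Φ a α s}
  obtain ⟨α, hα, O, hO, hαO, hdis⟩ := isolate (NN f A a) Nb (S.hA.mono fun α h => h.1) pathIm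
    (fun α h => alpha_closed (S.hdata.alpha α h.1)) (fun α h => alpha_preconn (S.hdata.alpha α h.1))
    (fun α h => pathIm_ne α) (fun α h α' h' hne => S.hdata.disjA h.1 h'.1 hne)
    (by rw [NN_union S ha]; exact (alpha_closed (S.hdata.alpha a ha)).preimage S.hf)
    (fun α h => h.1) (by
      obtain ⟨y, α, hα, s, hs, hs0, -, h⟩ := hbad
      exact ⟨α, hα, s, hs, hs0, h⟩)
  refine ⟨α, hα.1, hα.2, fun s hs => ?_⟩
  have hcl : IsClosed (Prod.snd '' (Gam A Φ ∩ Oᶜ ×ˢ univ)) :=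
    ((Gam_closed.inter (hO.isClosed_compl.prod isClosed_univ)).isCompact.image continuous_snd).isClosed
  have hy0 : b α (cT s) ∉ Prod.snd '' (Gam A Φ ∩ Oᶜ ×ˢ univ) := by
    rintro ⟨⟨x, y⟩, ⟨h1, h2, -⟩, h3⟩
    simp only at h3
    rw [h3] at h1
    obtain ⟨p, hp, hx, -⟩ := inv_arc S hα.1.1 (cT_mem hs) h1
    exact h2 (hαO ⟨p, hp, hx.symm⟩)
  filter_upwards [hcl.isOpen_compl.mem_nhds hy0] with y hy
  rintro ⟨α', hα', s', hs', hs0, rfl, hB⟩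
  by_cases he : α' = α
  · subst he; exact ⟨_, cT_mem hs', rfl⟩
  · exfalso
    apply hy
    have := hdis α' ⟨hα', s', hs', hs0, hB⟩ he
    exact ⟨(α' (cT s'), _), ⟨L3 S hα'.1 (cT_mem hs'), fun h => disjoint_left.1 this h ⟨_, cT_mem hs', rfl⟩, trivial⟩, rfl⟩

lemma no_bad (S : Setup f A B ext b Φ) {a : ℝ × ℝ → Sph} (ha : a ∈ A) : ¬ ∃ y, Bd f A b Φ a y := by
  intro hbad
  obtain ⟨α, hα, ⟨sb, hsb, hsb0, hBb⟩, hiso⟩ := isol S ha hbad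
  have hβ := betaB S hα.1
  have hβa := betaB S ha
  obtain ⟨σ, hσ, hσs⟩ : ∃ σ : ℝ, (σ = 1 ∨ σ = -1) ∧ 0 < σ * sb := by
    rcases lt_or_gt_of_ne hsb0 with h | h
    · exact ⟨-1, Or.inr rfl, by linarith⟩
    · exact ⟨1, Or.inl rfl, by linarith⟩
  have hσσ : ∀ t : ℝ, σ * (σ * t) = t := by
    intro t; rcases hσ with rfl | rfl <;> ring
  have hσI : ∀ t ∈ Icc (-1 : ℝ) 1, σ * t ∈ Icc (-1 : ℝ) 1 := by
    intro t ht
    rcases hσ with rfl | rfl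
    · simpa using ht
    · simpa using neg_Icc ht
  let γ : ℝ → Sph := fun t => b α (cT (σ * t))
  have hσc : Continuous (fun t : ℝ => σ * t) := continuous_const.mul continuous_id
  have hγc : ContinuousOn γ (Icc (-1) 1) := (beta_arc hβ).1.comp hσc.continuousOn hσI
  have hγi : InjOn γ (Icc (-1) 1) := by
    intro t ht t' ht' h
    have := (beta_arc hβ).2.1 (hσI t ht) (hσI t' ht') h
    rw [← hσσ t, this, hσσ]
  let tb := σ * sb
  have htb : tb ∈ Icc (-1 : ℝ) 1 := hσI _ hsb
  let Tb : Set ℝ := {t | t ∈ Icc tb 1 ∧ BT f A b Φ a α (σ * t)}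
  have hsubI : Icc tb 1 ⊆ Icc (-1 : ℝ) 1 := Icc_subset_Icc htb.1 le_rfl
  have hTbc : IsClosed Tb := by
    have c1 : ContinuousOn (fun t => (γ t, b a (cT (σ * t)))) (Icc tb 1) :=
      (hγc.mono hsubI).prodMk ((beta_arc hβa).1.comp hσc.continuousOn fun t ht => hσI t (hsubI ht))
    have c2 : ContinuousOn (fun t => (γ t, b a (cT (-(σ * t))))) (Icc tb 1) :=
      (hγc.mono hsubI).prodMk ((beta_arc hβa).1.comp hσc.neg.continuousOn fun t ht => neg_Icc (hσI t (hsubI ht)))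
    have k1 := c1.preimage_isClosed_of_isClosed isClosed_Icc (GamG_closed (f := f) (A := A) (Φ := Φ))
    have k2 := c2.preimage_isClosed_of_isClosed isClosed_Icc (GamG_closed (f := f) (A := A) (Φ := Φ))
    have : Tb = (Icc tb 1 ∩ (fun t => (γ t, b a (cT (σ * t)))) ⁻¹' GamG f A Φ) ∩
        (Icc tb 1 ∩ (fun t => (γ t, b a (cT (-(σ * t))))) ⁻¹' GamG f A Φ) := by
      ext t
      constructor
      · rintro ⟨h1, h2, h3⟩; exact ⟨⟨h1, h2⟩, h1, h3⟩
      · rintro ⟨⟨h1, h2⟩, -, h3⟩; exact ⟨h1, h2, h3⟩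
    rw [this]; exact k1.inter k2
  have hTbk : IsCompact Tb := isCompact_Icc.of_isClosed_subset hTbc fun t ht => ht.1
  obtain ⟨t0, ⟨ht0I, ht0B⟩, ht0max⟩ := hTbk.exists_isGreatest ⟨tb, left_mem_Icc.2 htb.2, by
    show BT f A b Φ a α (σ * (σ * sb))
    rw [hσσ]; exact hBb⟩
  have ht0' : t0 ∈ Icc (-1 : ℝ) 1 := hsubI ht0I
  have ht0pos : 0 < t0 := lt_of_lt_of_le hσs ht0I.1
  have hσt0 : σ * t0 ≠ 0 := by
    intro h
    have := hσσ t0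
    rw [h, mul_zero] at this
    exact ht0pos.ne this
  set s0 := σ * t0 with hs0
  have hs0I : s0 ∈ Icc (-1 : ℝ) 1 := hσI _ ht0'
  set y0 := γ t0 with hy0
  have hy0' : y0 = b α (cT s0) := rfl
  set vp := b a (cT s0) with hvp
  set vm := b a (cT (-s0)) with hvm
  have hvne : vp ≠ vm := by
    intro h
    have := (hβa.2 _ (cT_mem hs0I) _ (cT_mem (neg_Icc hs0I))).1 h
    have h2 : s0 = -s0 := this.2
    apply hσt0; linarith
  let arc := γ '' Icc (-1) t0
  have hsubI0 : Icc (-1) t0 ⊆ Icc (-1 : ℝ) 1 := Icc_subset_Icc le_rfl ht0'.2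
  -- bad points near y0 lie on the arc
  have hD1 : ∀ᶠ y in 𝓝 y0, Bd f A b Φ a y → y ∈ arc := by
    filter_upwards [hiso s0 hs0I] with y hy hyB
    obtain ⟨α', hα', s, hs, hs00, hys, hB⟩ := hyB
    have hy2 : y ∈ pathIm (b α) := hy ⟨α', hα', s, hs, hs00, hys, hB⟩
    obtain ⟨q, hq, hqy⟩ := hy2
    have := b_eq S hα.1 hα'.1 hq (cT_mem hs) (hqy.trans hys)
    subst this
    refine ⟨σ * s, ⟨(hσI s hs).1, ?_⟩, ?_⟩
    · by_contra! hlt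
      have : σ * s ∈ Tb := ⟨⟨ht0I.1.trans hlt.le, (hσI s hs).2⟩, by rw [hσσ]; exact hB⟩
      exact absurd (ht0max this) (not_le.2 hlt)
    · show b α (cT (σ * (σ * s))) = y
      rw [hσσ, hys]
  -- separating neighbourhoods
  obtain ⟨Wp, Wm, hWp, hWm, hpW, hmW, hWd⟩ := t2_separation hvne
  obtain ⟨Op, hOp, hOpc, hOpW⟩ := exists_mem_nhds_isClosed_subset (hWp.mem_nhds hpW)
  obtain ⟨Om, hOm, hOmc, hOmW⟩ := exists_mem_nhds_isClosed_subset (hWm.mem_nhds hmW)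
  have hOd : Disjoint Op Om := hWd.mono hOpW hOmW
  have hproj : ∀ C : Set Sph, IsClosed C → IsClosed (Prod.fst '' (GamG f A Φ ∩ univ ×ˢ C)) := fun C hC =>
    ((GamG_closed.inter (isClosed_univ.prod hC)).isCompact.image continuous_fst).isClosed
  have hy0val : ∀ v, (y0, v) ∈ GamG f A Φ → v = vp ∨ v = vm := by
    intro v hv
    obtain ⟨x, hx1, hx2⟩ := L2 S hv
    obtain ⟨p, hp, rfl, hp2⟩ := inv_arc S hα.1 (cT_mem hs0I) hx1
    rw [hα.2 p hp] at hx2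
    have e1 : b a p = vp := b_val S ha (cT_mem hs0I) hp hp2
    have e2 : b a (pbar p) = vm := b_val S ha (cT_mem (neg_Icc hs0I)) (pbar_mem hp) (by
      simp only [pbar, cT] at hp2 ⊢; rw [hp2])
    have := gval S ha hp hx2
    rwa [e1, e2] at this
  have hD2 : ∀ᶠ y in 𝓝 y0, ∀ v, (y, v) ∈ GamG f A Φ → v ∈ Op ∨ v ∈ Om := by
    have hc := hproj (interior Op ∪ interior Om)ᶜ (isOpen_interior.union isOpen_interior).isClosed_compl
    have : y0 ∉ Prod.fst '' (GamG f A Φ ∩ univ ×ˢ (interior Op ∪ interior Om)ᶜ) := by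
      rintro ⟨⟨y, v⟩, ⟨h1, -, h2⟩, rfl⟩
      apply h2
      rcases hy0val v h1 with h | h
      · left; simp only; rw [h]; exact mem_interior_iff_mem_nhds.2 hOp
      · right; simp only; rw [h]; exact mem_interior_iff_mem_nhds.2 hOm
    filter_upwards [hc.isOpen_compl.mem_nhds this] with y hy v hv
    by_contra hno
    push Not at hno
    apply hy
    refine ⟨(y, v), ⟨hv, trivial, ?_⟩, rfl⟩
    rintro (h | h)
    · exact hno.1 (interior_subset h)
    · exact hno.2 (interior_subset h)
  have hD3 : ∀ᶠ y in 𝓝 y0, ¬ Bd f A b Φ a y → ∀ v v', v ∈ Op → v' ∈ Om → (y, v) ∈ GamG f A Φ →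
      (y, v') ∈ GamG f A Φ → False := by
    by_contra hcon
    have hcl : y0 ∈ closure {y | ¬ (¬ Bd f A b Φ a y → ∀ v v', v ∈ Op → v' ∈ Om → (y, v) ∈ GamG f A Φ →
      (y, v') ∈ GamG f A Φ → False)} := mem_closure_iff_frequently.2 (not_eventually.1 hcon)
    obtain ⟨𝒰, hZ, hlim⟩ := mem_closure_iff_ultrafilter.1 hcl
    have hZ' : ∀ᶠ y in (𝒰 : Filter Sph), ∃ x v v', (x, y) ∈ Gam A Φ ∧ (f x, v) ∈ Gam A Φ ∧
        (f x, v') ∈ Gam A Φ ∧ f x ∉ pathIm a ∧ v ∈ Op ∧ v' ∈ Om := by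
      have hZ2 : ∀ᶠ y in (𝒰 : Filter Sph), ¬ (¬ Bd f A b Φ a y → ∀ v v', v ∈ Op → v' ∈ Om → (y, v) ∈ GamG f A Φ →
        (y, v') ∈ GamG f A Φ → False) := hZ
      filter_upwards [hZ2] with y hy
      push Not at hy
      obtain ⟨hyB, v, v', hv, hv', h1, h2, -⟩ := hy
      have hvv : v ≠ v' := fun h => disjoint_left.1 hOd hv (h ▸ hv')
      obtain ⟨α1, hα1, α2, hα2, hff, s, hs, hsne, hys, hvs⟩ := L5' S h1 h2 hvv
      have hne : a ≠ α2 := by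
        rintro rfl
        apply hyB
        refine ⟨α1, ⟨hα1, hff⟩, s, hs, hsne, hys, ?_⟩
        rw [hys] at h1 h2
        rcases hvs with ⟨e1, e2⟩ | ⟨e1, e2⟩
        · rw [e1] at h1; rw [e2] at h2; exact ⟨h1, h2⟩
        · rw [e1] at h1; rw [e2] at h2; exact ⟨h2, h1⟩
      have g1 : (α2 (cT s), b α2 (cT s)) ∈ Gam A Φ := L3 S hα2 (cT_mem hs)
      have g2 : (α2 (cT s), b α2 (cT (-s))) ∈ Gam A Φ := by
        have := L3 S hα2 (cT_mem (neg_Icc hs))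
        have e : α2 (cT (-s)) = α2 (cT s) := by
          refine ((S.hdata.alpha α2 hα2).2 _ (cT_mem (neg_Icc hs)) _ (cT_mem hs)).2 ⟨?_, Or.inr rfl⟩
          simp [cT]
        rwa [e] at this
      refine ⟨α1 (cT s), v, v', ?_, ?_, ?_, ?_, hv, hv'⟩
      · rw [hys]; exact L3 S hα1 (cT_mem hs)
      · rw [hff _ (cT_mem hs)]
        rcases hvs with ⟨e1, e2⟩ | ⟨e1, e2⟩ <;> rw [e1] <;> assumption
      · rw [hff _ (cT_mem hs)]
        rcases hvs with ⟨e1, e2⟩ | ⟨e1, e2⟩ <;> rw [e2] <;> assumption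
      · rw [hff _ (cT_mem hs)]
        exact fun h => disjoint_left.1 (S.hdata.disjA ha hα2 hne) h ⟨_, cT_mem hs, rfl⟩
    have : Nonempty Sph := ⟨y0⟩
    have hch : ∀ y : Sph, ∃ x v v', (∃ x v v', (x, y) ∈ Gam A Φ ∧ (f x, v) ∈ Gam A Φ ∧
        (f x, v') ∈ Gam A Φ ∧ f x ∉ pathIm a ∧ v ∈ Op ∧ v' ∈ Om) → (x, y) ∈ Gam A Φ ∧ (f x, v) ∈ Gam A Φ ∧
        (f x, v') ∈ Gam A Φ ∧ f x ∉ pathIm a ∧ v ∈ Op ∧ v' ∈ Om := by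
      intro y
      by_cases h : (∃ x v v', (x, y) ∈ Gam A Φ ∧ (f x, v) ∈ Gam A Φ ∧
        (f x, v') ∈ Gam A Φ ∧ f x ∉ pathIm a ∧ v ∈ Op ∧ v' ∈ Om)
      · obtain ⟨x, v, v', h'⟩ := h
        exact ⟨x, v, v', fun _ => h'⟩
      · exact ⟨y0, y0, y0, fun h' => absurd h' h⟩
    choose ξ w w' hch using hch
    have hev := hZ'.mono fun y hy => hch y hy
    obtain ⟨x0, -, hx0⟩ := isCompact_univ.ultrafilter_le_nhds (𝒰.map ξ) (by simp)
    have hx0 : Tendsto ξ (𝒰 : Filter Sph) (𝓝 x0) := hx0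
    have hx0y : (x0, y0) ∈ Gam A Φ := by
      refine Gam_closed.mem_of_tendsto (hx0.prodMk_nhds (show Tendsto id (𝒰 : Filter Sph) (𝓝 y0) from hlim)) ?_
      exact hev.mono fun y hy => hy.1
    obtain ⟨p, hp, rfl, -⟩ := inv_arc S hα.1 (cT_mem hs0I) hx0y
    have hfx0 : f (α p) ∈ pathIm a := ⟨p, hp, (hα.2 p hp).symm⟩
    obtain ⟨q, hq, -, hvl⟩ := LL S ha 𝒰 (fun y => f (ξ y)) (hev.mono fun y hy => hy.2.2.2.1) hfx0
      ((S.hf.tendsto _).comp hx0)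
    have m1 := hOpc.mem_of_tendsto (hvl w (hev.mono fun y hy => hy.2.1)) (hev.mono fun y hy => hy.2.2.2.2.1)
    have m2 := hOmc.mem_of_tendsto (hvl w' (hev.mono fun y hy => hy.2.2.1)) (hev.mono fun y hy => hy.2.2.2.2.2)
    exact disjoint_left.1 hOd m1 m2
  obtain ⟨D, hDsub, hDo, hyD⟩ := mem_nhds_iff.1 (Filter.inter_mem hD1 (Filter.inter_mem hD2 hD3))
  have d1 : ∀ y ∈ D, y ∉ arc → ¬ Bd f A b Φ a y := fun y hy hya hB => hya ((hDsub hy).1 hB)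
  have d2 : ∀ y ∈ D, ∀ v, (y, v) ∈ GamG f A Φ → v ∈ Op ∨ v ∈ Om := fun y hy => (hDsub hy).2.1
  have d3 : ∀ y ∈ D, y ∉ arc → ∀ v v', v ∈ Op → v' ∈ Om → (y, v) ∈ GamG f A Φ →
      (y, v') ∈ GamG f A Φ → False := fun y hy hya => (hDsub hy).2.2 (d1 y hy hya)
  classical
  let u : Sph → ℤ := fun y => if ∃ v ∈ Op, (y, v) ∈ GamG f A Φ then 1 else 0
  have hu : ContinuousOn u (D \ arc) := by
    rintro y ⟨hyD', hya⟩
    apply ContinuousAt.continuousWithinAt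
    by_cases hy : ∃ v ∈ Op, (y, v) ∈ GamG f A Φ
    · obtain ⟨v, hv, hyv⟩ := hy
      have hn : y ∉ Prod.fst '' (GamG f A Φ ∩ univ ×ˢ Om) := by
        rintro ⟨⟨y', v'⟩, ⟨h1, -, h2⟩, rfl⟩
        exact d3 _ hyD' hya v v' hv h2 hyv h1
      have : ∀ᶠ z in 𝓝 y, u z = 1 := by
        filter_upwards [(hproj Om hOmc).isOpen_compl.mem_nhds hn, hDo.mem_nhds hyD'] with z hz hzD
        obtain ⟨v, hv⟩ := GamG_ne S z
        rcases d2 z hzD v hv with h | h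
        · exact if_pos ⟨v, h, hv⟩
        · exact absurd ⟨(z, v), ⟨hv, trivial, h⟩, rfl⟩ hz
      exact (continuousAt_const (y := (1 : ℤ))).congr (this.mono fun z hz => hz.symm)
    · have hn : y ∉ Prod.fst '' (GamG f A Φ ∩ univ ×ˢ Op) := by
        rintro ⟨⟨y', v'⟩, ⟨h1, -, h2⟩, rfl⟩
        exact hy ⟨v', h2, h1⟩
      have : ∀ᶠ z in 𝓝 y, u z = 0 := by
        filter_upwards [(hproj Op hOpc).isOpen_compl.mem_nhds hn] with z hz
        refine if_neg ?_
        rintro ⟨v, h, hv⟩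
        exact hz ⟨(z, v), ⟨hv, trivial, h⟩, rfl⟩
      exact (continuousAt_const (y := (0 : ℤ))).congr (this.mono fun z hz => hz.symm)
  obtain ⟨W, hW, hWu⟩ := tip (hγc.mono hsubI0) (hγi.mono hsubI0) (by linarith) hDo hyD u hu
  have hoff : ∀ x ∈ (famIm A)ᶜ, Φ x ∉ arc := by
    rintro x hx ⟨t, ht, h⟩
    refine S.hreg.bijOn.mapsTo hx ?_
    rw [← h]
    exact not_fam (S.hdata.bij.mapsTo hα.1) (cT_mem (hσI t (hsubI0 ht)))
  have hpick : ∀ v, (y0, v) ∈ GamG f A Φ → ∀ O ∈ 𝓝 v, ∃ x ∈ (famIm A)ᶜ, Φ x ∈ W ∧ Φ x ∈ D ∧ Φ (f x) ∈ O := by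
    intro v hv O hO
    obtain ⟨_, ⟨⟨h1, h2⟩, h3⟩, x, hx, rfl⟩ := mem_closure_iff_nhds.1 hv _ (prod_mem_nhds (Filter.inter_mem hW (hDo.mem_nhds hyD)) hO)
    exact ⟨x, hx, h1, h2, h3⟩
  obtain ⟨x1, hx1, hx1W, hx1D, hx1O⟩ := hpick vp ht0B.1 Op hOp
  obtain ⟨x2, hx2, hx2W, hx2D, hx2O⟩ := hpick vm ht0B.2 Om hOm
  have e := hWu _ hx1W _ hx2W (hoff x1 hx1) (hoff x2 hx2)
  have e1 : u (Φ x1) = 1 := if_pos ⟨_, hx1O, subset_closure ⟨x1, hx1, rfl⟩⟩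
  have e2 : u (Φ x2) = 0 := by
    refine if_neg ?_
    rintro ⟨v, hv, h⟩
    exact d3 _ hx2D (hoff x2 hx2) v _ hv hx2O h (subset_closure ⟨x2, hx2, rfl⟩)
  rw [e1, e2] at e
  exact one_ne_zero e

lemma main_aux (S : Setup f A B ext b Φ) :
    ∃ g : Sph → Sph, Continuous g ∧ ∀ x ∈ (famIm A)ᶜ, g (Φ x) = Φ (f x) := by
  refine finish S fun y v v' h h' => ?_
  by_contra hne
  obtain ⟨α, hα, a, ha, hff, s, hs, hs0, hy, hv⟩ := L5' S h h' hne
  refine no_bad S ha ⟨y, α, ⟨hα, hff⟩, s, hs, hs0, hy, ?_⟩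
  rw [hy] at h h'
  rcases hv with ⟨e1, e2⟩ | ⟨e1, e2⟩
  · rw [e1] at h; rw [e2] at h'; exact ⟨h, h'⟩
  · rw [e1] at h; rw [e2] at h'; exact ⟨h', h⟩

end

/-- If `f : S² → S²` is continuous, `𝒜` is an `f`-stable countable set of
disjoint α-paths, and `Φ` is a regluing of `𝒜` into a set `ℬ` of disjoint β-paths, then the
map `Φ ∘ f ∘ Φ⁻¹` extends to a continuous map `g : S² → S²`. -/
theorem regluing_conjugate_extends_continuously (f : Sph → Sph) (hf : Continuous f)
    (A B : Set (ℝ × ℝ → Sph)) (ext : (ℝ × ℝ → Sph) → OP → Sph)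
    (b : (ℝ × ℝ → Sph) → ℝ × ℝ → Sph) (Φ : Sph → Sph)
    (hA : A.Countable) (hstable : FStable f A)
    (hdata : RegluingData A ext B b) (hreg : IsRegluing A ext B b Φ) :
    ∃ g : Sph → Sph, Continuous g ∧ ∀ x ∈ (famIm A)ᶜ, g (Φ x) = Φ (f x) := by
  exact main_aux ⟨hf, hA, hstable, hdata, hreg⟩
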